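/- arXiv:1709.03936 — 2 statements merged into one kernel-verified Lean document; each statement's English description precedes it below -/
import Mathlib

section
/- Let n ≥ d+3. Then every linear automorphism A of L_{d,n} is a scalar multiple of a signed permutation that is induced by a vertex relabeling of K_n. -/
/-- Edges of the complete graph `K_n`: unordered pairs of distinct vertices.
There are `N = C(n,2)` of them, and they index the coordinates of `ℂ^N`. -/
abbrev Edge (n : ℕ) : Type := {e : Sym2 (Fin n) // ¬ e.IsDiag}

/-- Complex squared length along an edge: `m_ij(p) = Σ_k (p_i^k − p_j^k)²`
(complex squares, no conjugation). -/
noncomputable def cSqLen {n d : ℕ} (p : Fin n → Fin d → ℂ) : Sym2 (Fin n) → ℂ :=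
  Sym2.lift ⟨fun i j => ∑ k, (p i k - p j k) ^ 2,
    fun i j => Finset.sum_congr rfl fun k _ => by ring⟩

/-- The squared measurement variety `M_{d,n}`: the image of the squared
measurement map over all complex configurations of `n` points in ℂ^d. -/
def Mvar (d n : ℕ) : Set (Edge n → ℂ) :=
  {w | ∃ p : Fin n → Fin d → ℂ, ∀ e : Edge n, w e = cSqLen p e.val}

/-- The coordinate-wise squaring map `s`. -/
def sqMap {n : ℕ} (w : Edge n → ℂ) : Edge n → ℂ := fun e => w e ^ 2

/-- The unsquared measurement variety `L_{d,n} = s⁻¹(M_{d,n})`. -/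
def Lvar (d n : ℕ) : Set (Edge n → ℂ) := sqMap ⁻¹' Mvar d n

namespace AutL

def IsDeg {n : ℕ} : ℕ → ((Edge n → ℂ) → ℂ) → Prop
  | 0, h => ∀ c y, h (y + c) = h y
  | k + 1, h => ∀ c, IsDeg k (fun y => h (y + c) - h y)

variable {n : ℕ}

lemma IsDeg.zero (k : ℕ) : IsDeg k (fun _ : Edge n → ℂ => (0 : ℂ)) := by
  induction k with
  | zero => intro c y; rfl
  | succ k ih => intro c; simpa using ih

lemma IsDeg.add : ∀ {k : ℕ} {f g : (Edge n → ℂ) → ℂ}, IsDeg k f → IsDeg k g →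
    IsDeg k (fun y => f y + g y) := by
  intro k
  induction k with
  | zero => intro f g hf hg c y; simp only [hf c y, hg c y]
  | succ k ih =>
    intro f g hf hg c
    have := ih (hf c) (hg c)
    convert this using 2
    ring

lemma IsDeg.smul : ∀ {k : ℕ} {f : (Edge n → ℂ) → ℂ} (a : ℂ), IsDeg k f →
    IsDeg k (fun y => a * f y) := by
  intro k
  induction k with
  | zero => intro f a hf c y; simp only [hf c y]
  | succ k ih =>
    intro f a hf c
    have := ih a (hf c)
    convert this using 2
    ring

lemma IsDeg.shift : ∀ {k : ℕ} {f : (Edge n → ℂ) → ℂ} (c : Edge n → ℂ), IsDeg k f →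
    IsDeg k (fun y => f (y + c)) := by
  intro k
  induction k with
  | zero => intro f a hf c y; show f (y + c + a) = f (y + a); rw [add_right_comm, hf]
  | succ k ih =>
    intro f a hf c
    have := ih a (hf c)
    convert this using 4
    exact add_right_comm _ _ _

lemma IsDeg.succ : ∀ {k : ℕ} {f : (Edge n → ℂ) → ℂ}, IsDeg k f → IsDeg (k + 1) f := by
  intro k
  induction k with
  | zero => intro f hf c c' y; simp only [hf c, sub_self]
  | succ k ih => intro f hf c; exact ih (hf c)

lemma IsDeg.mono {k l : ℕ} (h : k ≤ l) {f : (Edge n → ℂ) → ℂ} (hf : IsDeg k f) : IsDeg l f := by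
  induction h with
  | refl => exact hf
  | step _ ih => exact ih.succ

lemma IsDeg.mul_lin : ∀ {k : ℕ} {f : (Edge n → ℂ) → ℂ} (l : (Edge n → ℂ) → ℂ)
    (_ : ∀ y c, l (y + c) = l y + l c), IsDeg k f → IsDeg (k + 1) (fun y => l y * f y) := by
  intro k
  induction k with
  | zero =>
    intro f l hl hf c c' y
    simp only [hf _ _, hl]
    ring
  | succ k ih =>
    intro f l hl hf c
    have h1 := ih l hl (hf c)
    have h2 := (hf.shift c).smul (l c)
    convert h1.add h2 using 2
    simp only [hl]; ring

lemma IsDeg.sum {ι : Type*} (s : Finset ι) {k : ℕ} (f : ι → (Edge n → ℂ) → ℂ)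
    (h : ∀ i ∈ s, IsDeg k (f i)) : IsDeg k (fun y => ∑ i ∈ s, f i y) := by
  classical
  induction s using Finset.induction_on with
  | empty => simpa using IsDeg.zero k
  | insert a s ha ih =>
    simp only [Finset.sum_insert ha]
    exact (h a (by simp)).add (ih fun i hi => h i (by simp [hi]))

lemma IsDeg.prod_lin {ι : Type*} (s : Finset ι) (f : ι → (Edge n → ℂ) → ℂ)
    (h : ∀ i ∈ s, ∀ y c, f i (y + c) = f i y + f i c) :
    IsDeg s.card (fun y => ∏ i ∈ s, f i y) := by
  classical
  induction s using Finset.induction_on with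
  | empty => intro c y; simp
  | insert a s ha ih =>
    simp only [Finset.prod_insert ha, Finset.card_insert_of_notMem ha]
    exact (ih fun i hi => h i (by simp [hi])).mul_lin _ (h a (by simp))

lemma IsDeg.pow_mul {k : ℕ} {f : (Edge n → ℂ) → ℂ} (e : Edge n) (r : ℕ) (hf : IsDeg k f) :
    IsDeg (r + k) (fun y => y e ^ r * f y) := by
  induction r with
  | zero => simpa using hf
  | succ r ih =>
    have := ih.mul_lin (fun y => y e) (fun _ _ => rfl)
    have h2 : r + 1 + k = r + k + 1 := by ring
    rw [h2]
    convert this using 2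
    ring

lemma IsDeg.mono_prod (s : Finset (Edge n)) (m : Edge n → ℕ) :
    IsDeg (∑ e ∈ s, m e) (fun y => ∏ e ∈ s, y e ^ m e) := by
  classical
  induction s using Finset.induction_on with
  | empty => intro c y; simp
  | insert a s ha ih =>
    simp only [Finset.prod_insert ha, Finset.sum_insert ha]
    exact ih.pow_mul a (m a)

lemma IsDeg.eval {k : ℕ} (p : MvPolynomial (Edge n) ℂ) (hp : p.totalDegree ≤ k) :
    IsDeg k (fun y => MvPolynomial.eval y p) := by
  simp only [MvPolynomial.eval_eq']
  refine IsDeg.sum _ _ fun m hm => IsDeg.smul _ ?_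
  refine (IsDeg.mono_prod Finset.univ m).mono ?_
  have := MvPolynomial.le_totalDegree hm
  rw [Finsupp.sum_fintype _ _ (by simp)] at this
  omega

lemma cSqLen_mk {d : ℕ} (p : Fin n → Fin d → ℂ) (i j : Fin n) :
    cSqLen p s(i, j) = ∑ k, (p i k - p j k) ^ 2 := rfl

lemma Mvar_add {k : ℕ} {y c : Edge n → ℂ} (hy : y ∈ Mvar k n) (hc : c ∈ Mvar 1 n) :
    y + c ∈ Mvar (k + 1) n := by
  obtain ⟨p, hp⟩ := hy
  obtain ⟨q, hq⟩ := hc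
  refine ⟨fun i => Fin.snoc (p i) (q i 0), fun ⟨e, he⟩ => ?_⟩
  induction e using Sym2.ind with
  | _ i j =>
    simp only [Pi.add_apply, hp, hq, cSqLen_mk, Fin.sum_univ_castSucc (n := k)]
    simp

lemma Mvar_smul {k : ℕ} {y : Edge n → ℂ} (t : ℂ) (hy : y ∈ Mvar k n) :
    t • y ∈ Mvar k n := by
  obtain ⟨p, hp⟩ := hy
  obtain ⟨s, hs⟩ := IsAlgClosed.exists_pow_nat_eq t zero_lt_two
  refine ⟨fun i k => s * p i k, fun ⟨e, he⟩ => ?_⟩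
  induction e using Sym2.ind with
  | _ i j =>
    simp only [Pi.smul_apply, hp, cSqLen_mk, smul_eq_mul, Finset.mul_sum, ← hs]
    exact Finset.sum_congr rfl fun k _ => by ring

lemma Mvar_zero (k : ℕ) : (0 : Edge n → ℂ) ∈ Mvar k n := by
  refine ⟨0, fun ⟨e, he⟩ => ?_⟩
  induction e using Sym2.ind with
  | _ i j => simp [cSqLen_mk]

/-- rank one point -/
noncomputable def Y (q : Fin n → ℂ) : Edge n → ℂ := fun e => cSqLen (fun i (_ : Fin 1) => q i) e.val

lemma Y_mem (q : Fin n → ℂ) : Y q ∈ Mvar 1 n := ⟨_, fun _ => rfl⟩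

lemma Y_mk (q : Fin n → ℂ) (i j : Fin n) (h) : Y q ⟨s(i, j), h⟩ = (q i - q j) ^ 2 := by
  simp [Y, cSqLen_mk]

lemma KL : ∀ (k : ℕ) (h : (Edge n → ℂ) → ℂ), IsDeg k h → (∀ y ∈ Mvar k n, h y = 0) →
    ∀ y, h y = 0 := by
  intro k
  induction k with
  | zero =>
    intro h hd hv y
    have := hd y 0
    rw [zero_add] at this
    rw [this]; exact hv 0 (Mvar_zero 0)
  | succ k ih =>
    intro h hd hv
    have key : ∀ c ∈ Mvar 1 n, ∀ y, h (y + c) = h y := by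
      intro c hc y
      have := ih _ (hd c) (fun z hz => by
        rw [hv _ (Mvar_add hz hc), sub_eq_zero]
        have := hv _ (Mvar_add hz (Mvar_zero 1))
        rw [add_zero] at this
        exact this.symm) y
      exact sub_eq_zero.mp this
    have key2 : ∀ (e : Edge n) (t : ℂ) y, h (y + Pi.single e t) = h y := by
      rintro ⟨e, he⟩ t y
      induction e using Sym2.ind with
      | _ i j =>
      have hij : i ≠ j := by simpa using he
      have : y + Pi.single ⟨s(i,j), he⟩ t + (t / 2) • Y (Pi.single i 1 + Pi.single j 1) =
          y + (t / 2) • Y (Pi.single i 1) + (t / 2) • Y (Pi.single j 1) := by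
        ext ⟨e, he'⟩
        induction e using Sym2.ind with
        | _ a b =>
        have hab : a ≠ b := by simpa using he'
        simp only [Pi.add_apply, Pi.smul_apply, Y_mk, Pi.single_apply, smul_eq_mul, Subtype.mk.injEq, Sym2.eq_iff]
        by_cases h1 : a = i <;> by_cases h2 : a = j <;> by_cases h3 : b = i <;> by_cases h4 : b = j <;>
          simp_all <;> ring
      have h2 := congrArg h this
      rwa [key _ (Mvar_smul _ (Y_mem _)), key _ (Mvar_smul _ (Y_mem _)),
        key _ (Mvar_smul _ (Y_mem _))] at h2
    intro y
    have key3 : ∀ s : Finset (Edge n), h (∑ e ∈ s, Pi.single e (y e)) = h 0 := by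
      intro s
      classical
      induction s using Finset.induction_on with
      | empty => simp
      | insert a s ha ih => rw [Finset.sum_insert ha, add_comm, key2, ih]
    have := key3 Finset.univ
    rw [Finset.univ_sum_single] at this
    rw [this]; exact hv 0 (Mvar_zero _)

lemma Mvar_dense {d : ℕ} (hd : 1 ≤ d) (h : MvPolynomial (Edge n) ℂ)
    (hv : ∀ y ∈ Mvar d n, (∀ e, y e ≠ 0) → MvPolynomial.eval y h = 0) :
    ∀ y ∈ Mvar d n, MvPolynomial.eval y h = 0 := by
  rintro y ⟨p, hp⟩
  let p0 : Fin n → Fin d → ℂ := fun i _ => (i : ℕ)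
  have hq : ∀ e : Edge n, ∃ q : Polynomial ℂ, q ≠ 0 ∧
      ∀ t, q.eval t = cSqLen (fun i k => p i k + t * p0 i k) e.val := by
    rintro ⟨e, he⟩
    induction e using Sym2.ind with
    | _ i j =>
    have hij : i ≠ j := by simpa using he
    refine ⟨∑ k, (Polynomial.C (p i k - p j k) + Polynomial.X * Polynomial.C (p0 i k - p0 j k)) ^ 2, ?_, ?_⟩
    · intro h0
      have h2 := congrArg (fun q => Polynomial.coeff q 2) h0
      simp only [Polynomial.finsetSum_coeff, Polynomial.coeff_zero] at h2
      have h3 : ∀ a b : ℂ, ((Polynomial.C a + Polynomial.X * Polynomial.C b) ^ 2).coeff 2 = b ^ 2 := by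
        intro a b
        have : (Polynomial.C a + Polynomial.X * Polynomial.C b) ^ 2 =
          Polynomial.C (a ^ 2) + Polynomial.C (2 * a * b) * Polynomial.X + Polynomial.C (b ^ 2) * Polynomial.X ^ 2 := by
          simp only [map_pow, map_mul, map_ofNat]; ring
        rw [this]
        simp only [Polynomial.coeff_add, Polynomial.coeff_C_mul, Polynomial.coeff_X_pow, Polynomial.coeff_X, Polynomial.coeff_C]
        norm_num
      simp only [h3, p0, Finset.sum_const, Finset.card_univ, Fintype.card_fin, nsmul_eq_mul] at h2
      rcases mul_eq_zero.mp h2 with h4 | h4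
      · have : d = 0 := by exact_mod_cast h4
        omega
      · have h5 := pow_eq_zero_iff (two_ne_zero) |>.mp h4
        rw [sub_eq_zero] at h5
        exact hij (Fin.ext (by exact_mod_cast h5))
    · intro t
      simp only [Polynomial.eval_finsetSum, cSqLen_mk]
      refine Finset.sum_congr rfl fun k _ => ?_
      simp; ring
  choose q hq0 hqe using hq
  have hz : (MvPolynomial.aeval q h) * ∏ e, q e = 0 := by
    apply Polynomial.funext
    intro t
    rw [Polynomial.eval_mul, Polynomial.eval_prod, Polynomial.eval_zero]
    by_cases hall : ∀ e, (q e).eval t ≠ 0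
    · have : Polynomial.eval t (MvPolynomial.aeval q h) = MvPolynomial.eval (fun e => (q e).eval t) h := by
        rw [← Polynomial.coe_evalRingHom, MvPolynomial.aeval_def, MvPolynomial.hom_eval₂,
          MvPolynomial.eval, MvPolynomial.coe_eval₂Hom]
        congr 1
        ext; simp
      rw [this, hv _ ⟨_, fun e => hqe e t⟩ hall, zero_mul]
    · push Not at hall
      obtain ⟨e, he⟩ := hall
      rw [Finset.prod_eq_zero (Finset.mem_univ e) he, mul_zero]
  have hz2 : MvPolynomial.aeval q h = 0 := by
    rcases mul_eq_zero.mp hz with h1 | h1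
    · exact h1
    · exact absurd h1 (Finset.prod_ne_zero_iff.mpr fun e _ => hq0 e)
  have : Polynomial.eval 0 (MvPolynomial.aeval q h) = MvPolynomial.eval y h := by
    rw [← Polynomial.coe_evalRingHom, MvPolynomial.aeval_def, MvPolynomial.hom_eval₂,
      MvPolynomial.eval, MvPolynomial.coe_eval₂Hom]
    congr 1
    · ext; simp
    · ext e; simp [hqe, hp]
  rw [← this, hz2, Polynomial.eval_zero]

lemma even_support {d : ℕ} (hd : 1 ≤ d) (g : MvPolynomial (Edge n) ℂ)
    (hdeg : g.totalDegree ≤ 2 * (d + 1))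
    (hv : ∀ x ∈ Lvar d n, MvPolynomial.eval x g = 0) :
    ∀ m ∈ g.support, ∀ e, Even (m e) := by
  classical
  intro m0 hm0 e0
  by_contra hodd
  rw [Nat.not_even_iff_odd] at hodd
  let S := g.support.filter (fun m => ∀ e, m e % 2 = m0 e % 2)
  let hf : (Edge n →₀ ℕ) → (Edge n →₀ ℕ) := fun m => m.mapRange (· / 2) (by norm_num)
  let h : MvPolynomial (Edge n) ℂ := ∑ m ∈ S, MvPolynomial.monomial (hf m) (g.coeff m)
  have hhdeg : h.totalDegree ≤ d := by
    refine MvPolynomial.totalDegree_finsetSum_le fun m hm => ?_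
    refine (MvPolynomial.totalDegree_monomial_le _ _).trans ?_
    have hm' := Finset.mem_filter.mp hm
    have h1 := (MvPolynomial.le_totalDegree hm'.1).trans hdeg
    rw [Finsupp.sum_fintype _ _ (by simp)] at h1
    rw [Finsupp.sum_fintype _ _ (by simp)]
    have h2 : ∑ e, 2 * hf m e < ∑ e, m e := by
      refine Finset.sum_lt_sum (fun e _ => ?_) ⟨e0, Finset.mem_univ _, ?_⟩
      · simp only [hf, Finsupp.mapRange_apply]; omega
      · have := hm'.2 e0
        have := Nat.odd_iff.mp hodd
        simp only [hf, Finsupp.mapRange_apply]; omega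
    rw [← Finset.mul_sum] at h2
    simp only [id]
    omega
  have hvan : ∀ y ∈ Mvar d n, (∀ e, y e ≠ 0) → MvPolynomial.eval y h = 0 := by
    intro y hy hy0
    choose x hx using fun e => IsAlgClosed.exists_pow_nat_eq (y e) zero_lt_two
    have hx0 : ∀ e, x e ≠ 0 := fun e h0 => hy0 e (by rw [← hx, h0]; simp)
    let P : Finset (Edge n → ℂ) := Fintype.piFinset (fun _ => ({1, -1} : Finset ℂ))
    have hsum : ∑ ε ∈ P, (∏ e, ε e ^ m0 e) * MvPolynomial.eval (fun e => ε e * x e) g = 0 := by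
      refine Finset.sum_eq_zero fun ε hε => ?_
      rw [hv, mul_zero]
      show sqMap _ ∈ Mvar d n
      have : sqMap (fun e => ε e * x e) = y := by
        ext e
        have h1 := Fintype.mem_piFinset.mp hε e
        simp only [Finset.mem_insert, Finset.mem_singleton] at h1
        simp only [sqMap, mul_pow, hx]
        rcases h1 with h1 | h1 <;> simp [h1]
      rw [this]; exact hy
    simp only [MvPolynomial.eval_eq', Finset.mul_sum] at hsum
    rw [Finset.sum_comm] at hsum
    have hterm : ∀ m ∈ g.support, ∑ ε ∈ P, (∏ e, ε e ^ m0 e) * (g.coeff m * ∏ e, (ε e * x e) ^ m e)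
        = if (∀ e, m e % 2 = m0 e % 2) then
          (2 ^ (Fintype.card (Edge n)) * ∏ e, x e ^ (m0 e % 2)) * (g.coeff m * ∏ e, y e ^ (hf m e)) else 0 := by
      intro m _
      have e1 : ∀ ε : Edge n → ℂ, (∏ e, ε e ^ m0 e) * (g.coeff m * ∏ e, (ε e * x e) ^ m e)
          = (g.coeff m * ∏ e, x e ^ m e) * ∏ e, ε e ^ (m0 e + m e) := by
        intro ε
        simp only [mul_pow, pow_add, Finset.prod_mul_distrib]; ring
      simp only [e1]
      rw [← Finset.mul_sum, ← Finset.prod_univ_sum (fun _ => ({1, -1} : Finset ℂ)) (fun e z => z ^ (m0 e + m e))]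
      have h11 : (1 : ℂ) ≠ -1 := by norm_num
      simp only [Finset.sum_pair h11, one_pow]
      split_ifs with hpar
      · have : ∀ e, (1 : ℂ) + (-1) ^ (m0 e + m e) = 2 := by
          intro e
          have : Even (m0 e + m e) := by rw [Nat.even_iff]; have := hpar e; omega
          rw [this.neg_one_pow]; norm_num
        simp only [this, Finset.prod_const, Finset.card_univ]
        have hxx : ∏ e, x e ^ m e = (∏ e, x e ^ (m0 e % 2)) * ∏ e, y e ^ (hf m e) := by
          rw [← Finset.prod_mul_distrib]
          refine Finset.prod_congr rfl fun e _ => ?_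
          rw [← hx, ← pow_mul, ← pow_add]
          congr 1
          have := hpar e
          simp only [hf, Finsupp.mapRange_apply]; omega
        rw [hxx]; ring
      · push Not at hpar
        obtain ⟨e, he⟩ := hpar
        have : Odd (m0 e + m e) := by rw [Nat.odd_iff]; omega
        have h0 : (1 : ℂ) + (-1) ^ (m0 e + m e) = 0 := by rw [this.neg_one_pow]; norm_num
        rw [Finset.prod_eq_zero (f := fun e => (1 : ℂ) + (-1) ^ (m0 e + m e)) (Finset.mem_univ e) h0, mul_zero]
    rw [Finset.sum_congr rfl hterm, ← Finset.sum_filter, ← Finset.mul_sum] at hsum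
    have hne : (2 ^ (Fintype.card (Edge n)) * ∏ e, x e ^ (m0 e % 2)) ≠ 0 :=
      mul_ne_zero (pow_ne_zero _ two_ne_zero) (Finset.prod_ne_zero_iff.mpr fun e _ => pow_ne_zero _ (hx0 e))
    have := (mul_eq_zero.mp hsum).resolve_left hne
    simp only [h, map_sum, MvPolynomial.eval_monomial]
    rw [← this]
    refine Finset.sum_congr rfl fun m _ => ?_
    rw [Finsupp.prod_fintype _ _ (by simp)]
  have hzero : h = 0 := by
    apply MvPolynomial.funext
    intro y
    rw [map_zero]
    exact KL d _ (IsDeg.eval h hhdeg) (Mvar_dense hd h hvan) y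
  have hc : h.coeff (hf m0) = g.coeff m0 := by
    simp only [h, MvPolynomial.coeff_sum, MvPolynomial.coeff_monomial]
    rw [Finset.sum_eq_single m0]
    · simp
    · intro m hm hne
      rw [if_neg]
      intro heq
      apply hne
      ext e
      have h1 := DFunLike.congr_fun heq e
      have h2 := (Finset.mem_filter.mp hm).2 e
      simp only [hf, Finsupp.mapRange_apply] at h1
      omega
    · intro hm; exact absurd (Finset.mem_filter.mpr ⟨hm0, fun _ => rfl⟩) hm
  rw [hzero, MvPolynomial.coeff_zero] at hc
  exact MvPolynomial.mem_support_iff.mp hm0 hc.symm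

lemma even_eval {d : ℕ} (hd : 1 ≤ d) (g : MvPolynomial (Edge n) ℂ)
    (hdeg : g.totalDegree ≤ 2 * (d + 1))
    (hv : ∀ x ∈ Lvar d n, MvPolynomial.eval x g = 0) (x : Edge n → ℂ) (e : Edge n) :
    MvPolynomial.eval (Function.update x e (-x e)) g = MvPolynomial.eval x g := by
  classical
  simp only [MvPolynomial.eval_eq']
  refine Finset.sum_congr rfl fun m hm => ?_
  congr 1
  refine Finset.prod_congr rfl fun e' _ => ?_
  by_cases h : e' = e
  · subst h
    rw [Function.update_self, (even_support hd g hdeg hv m hm e').neg_pow]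
  · rw [Function.update_of_ne h]

/-- coordinates indexed by ordered pairs -/
def co {R : Type*} [Zero R] (x : Edge n → R) (i j : Fin n) : R :=
  if h : ¬ (s(i, j) : Sym2 (Fin n)).IsDiag then x ⟨s(i, j), h⟩ else 0

lemma co_ne {R : Type*} [Zero R] (x : Edge n → R) {i j : Fin n} (h : i ≠ j) :
    co x i j = x ⟨s(i, j), by simpa using h⟩ := by
  rw [co, dif_pos]

lemma co_self {R : Type*} [Zero R] (x : Edge n → R) (i : Fin n) : co x i i = 0 := by
  simp [co]

/-- (twice the) Gram matrix -/
def gm {R : Type*} [CommRing R] {d : ℕ} (τ : Fin (d + 2) → Fin n) (y : Edge n → R) :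
    Matrix (Fin (d + 1)) (Fin (d + 1)) R :=
  Matrix.of fun a b => co y (τ 0) (τ a.succ) + co y (τ 0) (τ b.succ) - co y (τ a.succ) (τ b.succ)

lemma co_add (x y : Edge n → ℂ) (i j : Fin n) : co (x + y) i j = co x i j + co y i j := by
  unfold co; split_ifs <;> simp

lemma co_smul (t : ℂ) (y : Edge n → ℂ) (i j : Fin n) : co (t • y) i j = t * co y i j := by
  unfold co; split_ifs <;> simp

lemma gm_add {d : ℕ} (τ : Fin (d + 2) → Fin n) (x y : Edge n → ℂ) :
    gm τ (x + y) = gm τ x + gm τ y := by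
  ext a b; simp only [gm, Matrix.of_apply, Matrix.add_apply, co_add]; ring

lemma gm_smul {d : ℕ} (τ : Fin (d + 2) → Fin n) (t : ℂ) (y : Edge n → ℂ) :
    gm τ (t • y) = t • gm τ y := by
  ext a b; simp only [gm, Matrix.of_apply, Matrix.smul_apply, co_smul, smul_eq_mul]; ring

lemma det_gm_Mvar {d : ℕ} (τ : Fin (d + 2) → Fin n) {y : Edge n → ℂ} (hy : y ∈ Mvar d n) :
    (gm τ y).det = 0 := by
  obtain ⟨p, hp⟩ := hy
  have hco : ∀ i j, co y i j = ∑ k, (p i k - p j k) ^ 2 := by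
    intro i j
    by_cases h : i = j
    · subst h; simp [co_self]
    · rw [co_ne _ h, hp, cSqLen_mk]
  let P : Matrix (Fin (d + 1)) (Fin d) ℂ := Matrix.of fun a k => p (τ a.succ) k - p (τ 0) k
  have : gm τ y = P * ((2 : ℂ) • P.transpose) := by
    ext a b
    simp only [gm, Matrix.of_apply, hco, Matrix.mul_apply, P, Matrix.transpose_apply,
      Matrix.smul_apply, smul_eq_mul]
    rw [← Finset.sum_add_distrib, ← Finset.sum_sub_distrib]
    exact Finset.sum_congr rfl fun k _ => by ring
  rw [this]
  by_contra hne
  have h1 : (P * ((2 : ℂ) • P.transpose)).rank = d + 1 := by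
    have := Matrix.rank_of_isUnit _ ((Matrix.isUnit_iff_isUnit_det _).mpr (isUnit_iff_ne_zero.mpr hne))
    simpa using this
  have h2 := Matrix.rank_mul_le_left P ((2 : ℂ) • P.transpose)
  have h3 := Matrix.rank_le_width P
  omega

lemma isDeg_det {d : ℕ} (τ : Fin (d + 2) → Fin n) (T : (Edge n → ℂ) → (Edge n → ℂ))
    (hT : ∀ x y, T (x + y) = T x + T y) :
    IsDeg (d + 1) (fun y => (gm τ (T y)).det) := by
  simp only [Matrix.det_apply']
  refine IsDeg.sum _ _ fun σ _ => IsDeg.smul _ ?_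
  have := IsDeg.prod_lin (n := n) (Finset.univ : Finset (Fin (d + 1)))
    (fun i y => gm τ (T y) (σ i) i) (fun i _ y c => by
      rw [hT, gm_add]; rfl)
  simpa using this

/-- the polynomial `det gm (A x)^2` -/
noncomputable def gpoly {d : ℕ} (τ : Fin (d + 2) → Fin n) (A : Matrix (Edge n) (Edge n) ℂ) :
    MvPolynomial (Edge n) ℂ :=
  (gm τ (fun e => (∑ f, MvPolynomial.C (A e f) * MvPolynomial.X f) ^ 2)).det

lemma eval_gpoly {d : ℕ} (τ : Fin (d + 2) → Fin n) (A : Matrix (Edge n) (Edge n) ℂ) (x) :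
    MvPolynomial.eval x (gpoly τ A) = (gm τ (sqMap (A.mulVec x))).det := by
  rw [gpoly, RingHom.map_det]
  congr 1
  have hco : ∀ i j, MvPolynomial.eval x (co (fun e => (∑ f, MvPolynomial.C (A e f) * MvPolynomial.X f) ^ 2) i j)
      = co (sqMap (A.mulVec x)) i j := by
    intro i j
    unfold co
    split_ifs
    · simp
    · simp [sqMap, Matrix.mulVec, dotProduct]
  ext a b
  simp [gm, hco]

lemma deg_gpoly {d : ℕ} (τ : Fin (d + 2) → Fin n) (A : Matrix (Edge n) (Edge n) ℂ) :
    (gpoly τ A).totalDegree ≤ 2 * (d + 1) := by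
  have hco : ∀ i j, (co (fun e => (∑ f, MvPolynomial.C (A e f) * MvPolynomial.X f) ^ 2 :
      Edge n → MvPolynomial (Edge n) ℂ) i j).totalDegree ≤ 2 := by
    intro i j
    unfold co
    split_ifs
    · simp
    · refine (MvPolynomial.totalDegree_pow _ _).trans ?_
      have : (∑ f, MvPolynomial.C (A ⟨s(i, j), by assumption⟩ f) * MvPolynomial.X f : MvPolynomial (Edge n) ℂ).totalDegree ≤ 1 := by
        refine MvPolynomial.totalDegree_finsetSum_le fun f _ => ?_
        refine (MvPolynomial.totalDegree_mul _ _).trans ?_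
        simp
      omega
  rw [gpoly, Matrix.det_apply]
  refine MvPolynomial.totalDegree_finsetSum_le fun σ _ => ?_
  have h1 : (∏ i, gm τ (fun e => (∑ f, MvPolynomial.C (A e f) * MvPolynomial.X f) ^ 2 :
      Edge n → MvPolynomial (Edge n) ℂ) (σ i) i).totalDegree ≤ 2 * (d + 1) := by
    refine (MvPolynomial.totalDegree_finsetProd _ _).trans ?_
    refine (Finset.sum_le_card_nsmul _ _ 2 fun i _ => ?_).trans (by simp; omega)
    simp only [gm, Matrix.of_apply]
    refine (MvPolynomial.totalDegree_sub _ _).trans (max_le ?_ (hco _ _))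
    exact (MvPolynomial.totalDegree_add _ _).trans (max_le (hco _ _) (hco _ _))
  rcases Int.units_eq_one_or (Equiv.Perm.sign σ) with h | h <;> rw [h]
  · simpa using h1
  · simpa using h1

/-- an injection with three prescribed values avoiding a point -/
lemma exists_tau {d : ℕ} (hn : d + 3 ≤ n) (a b : Fin (d + 1)) (hab : a ≠ b) (i k l w : Fin n)
    (hik : i ≠ k) (hil : i ≠ l) (hkl : k ≠ l) (hiw : i ≠ w) (hkw : k ≠ w) (hlw : l ≠ w) :
    ∃ τ : Fin (d + 2) → Fin n, Function.Injective τ ∧ τ 0 = i ∧ τ a.succ = k ∧ τ b.succ = l ∧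
      ∀ c, τ c ≠ w := by
  obtain ⟨m, rfl⟩ : ∃ m, n = m + 1 := ⟨n - 1, by omega⟩
  let t0 : Fin (d + 2) → Fin (m + 1) := fun c => w.succAbove (Fin.castLE (by omega) c)
  have i0 : Function.Injective t0 := fun x y h => by
    simpa [t0] using h
  have w0 : ∀ c, t0 c ≠ w := fun c => Fin.succAbove_ne _ _
  have step : ∀ (t : Fin (d + 2) → Fin (m + 1)) (_ : Function.Injective t) (_ : ∀ c, t c ≠ w)
      (c : Fin (d + 2)) (v : Fin (m + 1)) (_ : v ≠ w), ∃ t' : Fin (d + 2) → Fin (m + 1),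
      Function.Injective t' ∧ (∀ c, t' c ≠ w) ∧ t' c = v ∧ ∀ c', c' ≠ c → t c' ≠ v → t' c' = t c' := by
    intro t ht hw c v hv
    refine ⟨fun x => Equiv.swap (t c) v (t x), (Equiv.injective _).comp ht, ?_, by simp, ?_⟩
    · intro x h
      have : t x = Equiv.swap (t c) v w := by rw [← h, Equiv.swap_apply_self]
      rw [Equiv.swap_apply_of_ne_of_ne (hw c).symm hv.symm] at this
      exact hw x this
    · intro c' h1 h2
      exact Equiv.swap_apply_of_ne_of_ne (fun h => h1 (ht h)) h2
  obtain ⟨t1, i1, w1, e1, -⟩ := step t0 i0 w0 0 i hiw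
  obtain ⟨t2, i2, w2, e2, f2⟩ := step t1 i1 w1 a.succ k hkw
  obtain ⟨t3, i3, w3, e3, f3⟩ := step t2 i2 w2 b.succ l hlw
  have h20 : t2 0 = i := by
    rw [f2 0 (Fin.succ_ne_zero a).symm (by rw [e1]; exact hik), e1]
  refine ⟨t3, i3, ?_, ?_, e3, w3⟩
  · rw [f3 0 (Fin.succ_ne_zero b).symm (by rw [h20]; exact hil), h20]
  · rw [f3 a.succ (by simpa using hab) (by rw [e2]; exact hkl), e2]

/-- nondegeneracy -/
lemma nondeg {d : ℕ} (τ : Fin (d + 2) → Fin n) (hτ : Function.Injective τ) (a b : Fin (d + 1))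
    (hab : a ≠ b) (e : Edge n) (he : e.val = s(τ a.succ, τ b.succ))
    (h : ∀ (x : Edge n → ℂ) (t : ℂ), (gm τ (sqMap (x + t • Pi.single e 1))).det = (gm τ (sqMap x)).det) :
    False := by
  classical
  obtain ⟨r, hr⟩ := IsAlgClosed.exists_pow_nat_eq (2 : ℂ) zero_lt_two
  let z : Edge n → ℂ := fun f => if τ 0 ∈ f.val then 1 else r
  have hz := h z (-r)
  have hne : ∀ c : Fin (d + 1), τ 0 ≠ τ c.succ := fun c hc => Fin.succ_ne_zero c (hτ hc).symm
  have hne' : ∀ c c' : Fin (d + 1), c ≠ c' → τ c.succ ≠ τ c'.succ := fun c c' hc h =>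
    hc (Fin.succ_injective _ (hτ h))
  have hze : z e = r := by simp [z, he, hne]
  have g1 : gm τ (sqMap z) = (2 : ℂ) • (1 : Matrix (Fin (d + 1)) (Fin (d + 1)) ℂ) := by
    ext c c'
    simp only [gm, Matrix.of_apply, co_ne _ (hne _), Matrix.smul_apply, Matrix.one_apply, smul_eq_mul]
    by_cases hcc : c = c'
    · subst hcc
      simp [co_self, sqMap, z]; norm_num
    · rw [co_ne _ (hne' _ _ hcc)]
      simp [sqMap, z, hne, hcc, hr]; norm_num
  have g2 : (gm τ (sqMap (z + (-r) • Pi.single e 1))).det = 0 := by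
    have hv : ∀ f, sqMap (z + (-r) • Pi.single e 1) f = if f = e then 0 else sqMap z f := by
      intro f
      by_cases hf : f = e
      · subst hf; simp [sqMap, hze]
      · simp [sqMap, hf]
    apply Matrix.det_zero_of_row_eq hab
    ext c
    have hq : ∀ c c' : Fin (d + 1), c ≠ c' → co (sqMap (z + (-r) • Pi.single e 1)) (τ c.succ) (τ c'.succ)
        = if (s(τ c.succ, τ c'.succ) = e.val) then 0 else 2 := by
      intro c c' hcc
      rw [co_ne _ (hne' _ _ hcc), hv]
      simp [Subtype.ext_iff, sqMap, z, hne, hr]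
    have hq0 : ∀ c : Fin (d + 1), co (sqMap (z + (-r) • Pi.single e 1)) (τ 0) (τ c.succ) = 1 := by
      intro c
      rw [co_ne _ (hne _), hv, if_neg]
      · simp [sqMap, z]
      · intro h
        have := congrArg Subtype.val h
        rw [he] at this
        have h3 : τ 0 ∈ s(τ a.succ, τ b.succ) := by rw [← this]; simp
        simp [hne] at h3
    simp only [gm, Matrix.of_apply, hq0]
    congr 1
    have hinj : ∀ c c' : Fin (d+1), τ c.succ = τ c'.succ ↔ c = c' := fun c c' => by
      rw [hτ.eq_iff, Fin.succ_inj]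
    by_cases h1 : a = c
    · subst h1
      rw [co_self, hq _ _ (Ne.symm hab), if_pos]
      rw [he, Sym2.eq_swap]
    · by_cases h2 : b = c
      · subst h2
        rw [co_self, hq _ _ hab, if_pos he.symm]
      · rw [hq _ _ h1, hq _ _ h2, if_neg, if_neg]
        · rw [he, Sym2.eq_iff]; simp [hinj]; tauto
        · rw [he, Sym2.eq_iff]; simp [hinj]; tauto
  rw [g2, g1, Matrix.det_smul, Matrix.det_one, mul_one] at hz
  exact pow_ne_zero _ two_ne_zero hz.symm

lemma flip {F : (Edge n → ℂ) → ℂ} (e : Edge n) (hr : ∀ x, F (Function.update x e (-x e)) = F x)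
    (v : Edge n → ℂ) (hv : ∀ x (t : ℂ), F (x + t • v) = F x) (x) (t : ℂ) :
    F (x + t • (v e • Pi.single e 1)) = F x := by
  classical
  have h1 : x + t • (v e • Pi.single e 1) =
      (x + (-t / 2) • Function.update v e (-v e)) + (t / 2) • v := by
    ext f
    by_cases hf : f = e
    · subst hf; simp; ring
    · simp [hf]; ring
  have h2 : x + (-t / 2) • Function.update v e (-v e) =
      Function.update (Function.update x e (-x e) + (-t / 2) • v) e
        (-((Function.update x e (-x e) + (-t / 2) • v) e)) := by
    ext f
    by_cases hf : f = e
    · subst hf; simp; ring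
    · simp [hf]
  rw [h1, hv, h2, hr, hv, hr]

lemma sqMap_flip (x : Edge n → ℂ) (e : Edge n) : sqMap (Function.update x e (-x e)) = sqMap x := by
  ext f
  by_cases hf : f = e
  · subst hf; simp [sqMap]
  · simp [sqMap, hf]

lemma exists_fresh (hn : 4 ≤ n) (i j k : Fin n) : ∃ l, l ≠ i ∧ l ≠ j ∧ l ≠ k := by
  by_contra h
  push Not at h
  have : (Finset.univ : Finset (Fin n)) ⊆ {i, j, k} := by
    intro l _
    simp only [Finset.mem_insert, Finset.mem_singleton]
    by_cases h1 : l = i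
    · exact Or.inl h1
    · by_cases h2 : l = j
      · exact Or.inr (Or.inl h2)
      · exact Or.inr (Or.inr (h l h1 h2))
  have h1 := Finset.card_le_card this
  have h2 : ({i, j, k} : Finset (Fin n)).card ≤ 3 := Finset.card_le_three
  simp at h1
  omega

lemma mono_col {d : ℕ} (hd : 1 ≤ d) (hn : d + 3 ≤ n) (A : Matrix (Edge n) (Edge n) ℂ)
    (hunit : IsUnit A.det) (haut : ∀ x ∈ Lvar d n, A.mulVec x ∈ Lvar d n) (e : Edge n) :
    ∃ e', ∀ e'', e'' ≠ e → A e'' e' = 0 := by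
  classical
  have hAB : ∀ x, A.mulVec (A⁻¹.mulVec x) = x := by
    intro x; rw [Matrix.mulVec_mulVec, Matrix.mul_nonsing_inv A hunit, Matrix.one_mulVec]
  set v := A⁻¹.mulVec (Pi.single e 1) with hvdef
  have hAv : A.mulVec v = Pi.single e 1 := hAB _
  have hv0 : v ≠ 0 := by
    intro h
    rw [h, Matrix.mulVec_zero] at hAv
    have := congrFun hAv e
    simp at this
  obtain ⟨e', he'⟩ : ∃ e', v e' ≠ 0 := by
    by_contra h
    push Not at h
    exact hv0 (funext h)
  refine ⟨e', fun e'' hne => ?_⟩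
  by_contra hA0
  obtain ⟨e, he⟩ := e
  obtain ⟨e'', he''⟩ := e''
  induction e'' using Sym2.ind with
  | _ k l =>
  have hkl : k ≠ l := by simpa using he''
  obtain ⟨w, hwe, hwk, hwl⟩ : ∃ w, w ∈ e ∧ w ≠ k ∧ w ≠ l := by
    induction e using Sym2.ind with
    | _ i j =>
    have hij : i ≠ j := by simpa using he
    have h1 : ¬ (s(k, l) = s(i, j)) := fun h => hne (Subtype.ext h)
    rw [Sym2.eq_iff] at h1
    by_cases h2 : i ≠ k ∧ i ≠ l
    · exact ⟨i, by simp, h2.1, h2.2⟩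
    · refine ⟨j, by simp, ?_, ?_⟩
      · rintro rfl; grind
      · rintro rfl; grind
  obtain ⟨i, hik, hil, hiw⟩ := exists_fresh (by omega) k l w
  let a : Fin (d + 1) := ⟨0, by omega⟩
  let b : Fin (d + 1) := ⟨1, by omega⟩
  have hab : a ≠ b := by simp [a, b]
  obtain ⟨τ, hτ, -, ha, hb, hw⟩ := exists_tau hn a b hab i k l w hik hil hkl hiw (Ne.symm hwk) (Ne.symm hwl)
  let f : (Edge n → ℂ) → ℂ := fun x => (gm τ (sqMap x)).det
  have hfe : ∀ x (t : ℂ), f (x + t • Pi.single ⟨e, he⟩ 1) = f x := by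
    intro x t
    simp only [f]
    have hco : ∀ c c', co (sqMap (x + t • Pi.single ⟨e, he⟩ 1)) (τ c) (τ c') = co (sqMap x) (τ c) (τ c') := by
      intro c c'
      unfold co
      split_ifs with h1
      · rfl
      · have : (⟨s(τ c, τ c'), h1⟩ : Edge n) ≠ ⟨e, he⟩ := by
          intro h
          have h2 := congrArg Subtype.val h
          simp only at h2
          rw [← h2] at hwe
          simp only [Sym2.mem_iff] at hwe
          rcases hwe with h3 | h3
          · exact hw c h3.symm
          · exact hw c' h3.symm
        simp [sqMap, this]
    congr 1
    ext c c'
    simp only [gm, Matrix.of_apply, hco]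
  let F : (Edge n → ℂ) → ℂ := fun x => f (A.mulVec x)
  have hFr : ∀ x, F (Function.update x e' (-x e')) = F x := by
    intro x
    have := even_eval hd (gpoly τ A) (deg_gpoly τ A) (fun x hx => by
      rw [eval_gpoly]; exact det_gm_Mvar τ (haut x hx)) x e'
    rw [eval_gpoly, eval_gpoly] at this
    exact this
  have hFv : ∀ x (t : ℂ), F (x + t • v) = F x := by
    intro x t
    simp only [F, Matrix.mulVec_add, Matrix.mulVec_smul, hAv, hfe]
  have h1 := flip e' hFr v hFv
  have h2 : ∀ z (t : ℂ), f (z + t • (v e' • A.mulVec (Pi.single e' 1))) = f z := by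
    intro z t
    have := h1 (A⁻¹.mulVec z) t
    simpa only [F, Matrix.mulVec_add, Matrix.mulVec_smul, hAB] using this
  have h3 := flip (F := f) ⟨s(k, l), he''⟩ (fun x => by simp only [f, sqMap_flip]) _ h2
  have hcol : (v e' • A.mulVec (Pi.single e' 1)) ⟨s(k, l), he''⟩ = v e' * A ⟨s(k, l), he''⟩ e' := by
    simp
  rw [hcol] at h3
  have hne0 := mul_ne_zero he' hA0
  refine nondeg τ hτ a b hab ⟨s(k, l), he''⟩ (by rw [ha, hb]) fun x t => ?_
  have := h3 x (t / (v e' * A ⟨s(k, l), he''⟩ e'))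
  rw [smul_smul, div_mul_cancel₀ _ hne0] at this
  exact this

lemma exists_diag {d : ℕ} (τ : Fin (d + 2) → Fin n) (hτ : Function.Injective τ)
    (w : Fin (d + 1) → ℂ) : ∃ z : Edge n → ℂ, gm τ z = Matrix.diagonal (fun a => 2 * w a) := by
  let ω : Fin n → ℂ := Function.extend τ (Fin.cons 0 w : Fin (d + 2) → ℂ) 0
  have hω : ∀ c, ω (τ c) = (Fin.cons 0 w : Fin (d + 2) → ℂ) c := fun c => hτ.extend_apply _ _ _
  let z : Edge n → ℂ := fun e => Sym2.lift ⟨fun i j => ω i + ω j, fun i j => add_comm _ _⟩ e.val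
  have hz : ∀ i j, i ≠ j → co z i j = ω i + ω j := by
    intro i j h; rw [co_ne _ h]; rfl
  refine ⟨z, ?_⟩
  have hne : ∀ c : Fin (d + 1), τ 0 ≠ τ c.succ := fun c hc => Fin.succ_ne_zero c (hτ hc).symm
  ext a b
  simp only [gm, Matrix.of_apply, hz _ _ (hne _)]
  by_cases hab : a = b
  · subst hab
    rw [co_self, Matrix.diagonal_apply_eq]
    simp only [hω, Fin.cons_zero, Fin.cons_succ]; ring
  · rw [hz _ _ (fun h => hab (Fin.succ_injective _ (hτ h))), Matrix.diagonal_apply_ne _ hab]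
    simp only [hω, Fin.cons_zero, Fin.cons_succ]; ring

lemma det_two {m : ℕ} (a b : Fin m) (hab : a ≠ b) (G : Matrix (Fin m) (Fin m) ℂ) :
    (Matrix.diagonal (fun i => if i = a ∨ i = b then (0 : ℂ) else 1) +
      Matrix.diagonal (fun i => if i = a ∨ i = b then (1 : ℂ) else 0) * G).det
      = G a a * G b b - G a b * G b a := by
  rw [Matrix.twoBlockTriangular_det _ (fun i => i = a ∨ i = b)]
  · have hbij : Function.Bijective (![⟨a, Or.inl rfl⟩, ⟨b, Or.inr rfl⟩] : Fin 2 → {i // i = a ∨ i = b}) := by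
      constructor
      · intro x y h
        fin_cases x <;> fin_cases y <;> simp_all
      · rintro ⟨x, rfl | rfl⟩
        · exact ⟨0, rfl⟩
        · exact ⟨1, rfl⟩
    rw [← Matrix.det_submatrix_equiv_self (Equiv.ofBijective _ hbij), Matrix.det_fin_two]
    have h2 : Matrix.toSquareBlockProp (Matrix.diagonal (fun i => if i = a ∨ i = b then (0 : ℂ) else 1) +
      Matrix.diagonal (fun i => if i = a ∨ i = b then (1 : ℂ) else 0) * G) (fun i => ¬ (i = a ∨ i = b)) = 1 := by
      ext ⟨i, hi⟩ ⟨j, hj⟩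
      simp [Matrix.toSquareBlockProp, Matrix.diagonal_apply, Matrix.one_apply, hi]
    rw [h2, Matrix.det_one, mul_one]
    simp [Matrix.toSquareBlockProp, Matrix.diagonal_apply, hab, hab.symm]
  · intro i hi j hj
    have : i ≠ j := by rintro rfl; exact hi hj
    simp [Matrix.diagonal_apply, hi, this]

lemma minor_zero {d : ℕ} (τ : Fin (d + 2) → Fin n) (hτ : Function.Injective τ) (a b : Fin (d + 1))
    (hab : a ≠ b) (c : Edge n → ℂ)
    (h : ∀ z, (gm τ (z + c)).det + (gm τ (z + (-1 : ℂ) • c)).det = 2 * (gm τ z).det) :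
    gm τ c a a * gm τ c b b = gm τ c a b * gm τ c b a := by
  let E : Matrix (Fin (d + 1)) (Fin (d + 1)) ℂ :=
    Matrix.diagonal (fun i => if i = a ∨ i = b then (0 : ℂ) else 1)
  let R : ℂ → Matrix (Fin (d + 1)) (Fin (d + 1)) ℂ := fun ρ =>
    Matrix.diagonal (fun i => if i = a ∨ i = b then (1 : ℂ) else ρ)
  have key : ∀ ρ : ℂ, ρ ≠ 0 → (E + R ρ * gm τ c).det + (E + R ρ * ((-1 : ℂ) • gm τ c)).det = 0 := by
    intro ρ hρ
    obtain ⟨z, hz⟩ := exists_diag τ hτ (fun i => if i = a ∨ i = b then (0 : ℂ) else ρ⁻¹ / 2)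
    have h1 := h z
    rw [gm_add, gm_add, gm_smul] at h1
    have hE : R ρ * gm τ z = E := by
      rw [hz, Matrix.diagonal_mul_diagonal]
      congr 1
      ext i
      split_ifs
      · simp
      · field_simp
    have h0 : (gm τ z).det = 0 := by
      rw [hz, Matrix.det_diagonal]
      exact Finset.prod_eq_zero (Finset.mem_univ a) (by simp)
    rw [← hE, ← mul_add, ← mul_add, Matrix.det_mul, Matrix.det_mul, ← mul_add, h1, h0]
    simp
  have hRc : Continuous R := by
    refine Continuous.matrix_diagonal ?_
    refine continuous_pi fun i => ?_
    split_ifs <;> fun_prop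
  have hcont : Continuous (fun ρ => (E + R ρ * gm τ c).det + (E + R ρ * ((-1 : ℂ) • gm τ c)).det) := by
    refine Continuous.add (Continuous.matrix_det ?_) (Continuous.matrix_det ?_)
    · exact continuous_const.add (hRc.matrix_mul continuous_const)
    · exact continuous_const.add (hRc.matrix_mul continuous_const)
  have h0 := congrFun (Continuous.ext_on (dense_compl_singleton (0 : ℂ)) hcont
    (continuous_const (y := (0 : ℂ))) (fun ρ hρ => key ρ hρ)) 0
  simp only [E, R] at h0
  rw [det_two a b hab, det_two a b hab] at h0
  simp only [Matrix.smul_apply, smul_eq_mul] at h0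
  linear_combination h0 / 2

lemma flat {d : ℕ} (hd : 1 ≤ d) (hn : d + 3 ≤ n) (α : Edge n → ℂ) (hα : ∀ e, α e ≠ 0)
    (π : Edge n ≃ Edge n) (hA : ∀ y ∈ Mvar d n, (fun e => α e * y (π e)) ∈ Mvar d n)
    (i k l : Fin n) (hik : i ≠ k) (hil : i ≠ l) (hkl : k ≠ l) (q : Fin n → ℂ)
    (c : Edge n → ℂ) (hc : c = fun e => α e * Y q (π e)) :
    4 * co c i k * co c i l = (co c i k + co c i l - co c k l) ^ 2 := by
  obtain ⟨d, rfl⟩ : ∃ d', d = d' + 1 := ⟨d - 1, by omega⟩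
  obtain ⟨w, h1, h2, h3⟩ := exists_fresh (by omega) i k l
  let a : Fin (d + 1 + 1) := 0
  let b : Fin (d + 1 + 1) := 1
  have hab : a ≠ b := by simp [a, b]
  obtain ⟨τ, hτ, h0, ha, hb, -⟩ := exists_tau hn a b hab i k l w hik hil hkl h1.symm h2.symm h3.symm
  let T : (Edge n → ℂ) → (Edge n → ℂ) := fun y e => α e * y (π e)
  have hT : ∀ x y, T (x + y) = T x + T y := by
    intro x y; ext e; simp [T, mul_add]
  have hdeg := isDeg_det τ T hT
  have hmem : ∀ t : ℂ, t • Y q ∈ Mvar 1 n := fun t => Mvar_smul t (Y_mem q)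
  have hvan : ∀ y ∈ Mvar (d + 1) n, (gm τ (T y)).det = 0 := fun y hy => det_gm_Mvar τ (hA y hy)
  have hK := KL d _ (hdeg (Y q) ((-1 : ℂ) • Y q)) (by
    intro y hy
    beta_reduce
    have e1 : y + (-1 : ℂ) • Y q + Y q = y + 0 := by simp
    rw [e1, hvan _ (Mvar_add hy (Mvar_zero 1)), hvan _ (Mvar_add hy (hmem _)),
      hvan _ (Mvar_add hy (Y_mem q))]
    have := hvan _ (Mvar_add hy (Mvar_zero 1))
    rw [add_zero] at this
    rw [this]; ring)
  have hTc : T (Y q) = c := hc.symm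
  have hTc' : T ((-1 : ℂ) • Y q) = (-1 : ℂ) • c := by
    rw [← hTc]; ext e; simp [T]
  have hm := minor_zero τ hτ a b hab c (by
    intro z
    let y : Edge n → ℂ := fun e => z (π.symm e) / α (π.symm e)
    have hy : T y = z := by
      ext e; simp only [T, y, Equiv.symm_apply_apply]; field_simp [hα e]
    have := hK y
    beta_reduce at this
    have e1 : y + (-1 : ℂ) • Y q + Y q = y := by simp
    rw [e1, hT, hT, hTc, hTc', hy] at this
    linear_combination -this)
  simp only [gm, Matrix.of_apply, h0, ha, hb, co_self] at hm
  have hs : co c l k = co c k l := by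
    unfold co; simp only [Sym2.eq_swap (a := l) (b := k)]
  rw [hs] at hm
  linear_combination hm

lemma comb (hn : 4 ≤ n) (m : Fin n → Fin n → Fin n → Prop)
    (sym : ∀ v i j, m v i j → m v j i)
    (ex : ∀ i j, i ≠ j → ∃ v w, v ≠ w ∧ m v i j ∧ m w i j ∧ ∀ u, m u i j → u = v ∨ u = w)
    (U : ∀ i j k l v w, i ≠ j → k ≠ l → v ≠ w → m v i j → m w i j → m v k l → m w k l →
      s(i, j) = s(k, l))
    (T1 : ∀ i k l v, i ≠ k → i ≠ l → k ≠ l → m v i k → m v i l ∨ m v k l) :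
    (∀ i k l v, i ≠ k → i ≠ l → k ≠ l → m v i k → m v i l → ¬ m v k l) ∧
    (∀ i k l, i ≠ k → i ≠ l → k ≠ l → ∃ v, m v i k ∧ m v i l) ∧
    ∃ ρ : Fin n → Fin n, Function.Injective ρ ∧ ∀ i j, i ≠ j → m (ρ i) i j := by
  have T3 : ∀ i k l v, i ≠ k → i ≠ l → k ≠ l → m v i k → m v i l → ¬ m v k l := by
    intro i k l v hik hil hkl h1 h2 h3
    obtain ⟨a, hav, ha⟩ : ∃ a, a ≠ v ∧ m a i k := by
      obtain ⟨x, y, hxy, hx, hy, -⟩ := ex i k hik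
      by_cases h : x = v
      · exact ⟨y, fun h' => hxy (h.trans h'.symm), hy⟩
      · exact ⟨x, h, hx⟩
    rcases T1 i k l a hik hil hkl ha with h | h
    · have := U i k i l a v hik hil hav ha h1 h h2
      rw [Sym2.eq_iff] at this; grind
    · have := U i k k l a v hik hkl hav ha h1 h h3
      rw [Sym2.eq_iff] at this; grind
  have Adj : ∀ i k l, i ≠ k → i ≠ l → k ≠ l → ∃ v, m v i k ∧ m v i l := by
    intro i k l hik hil hkl
    obtain ⟨x, y, hxy, hx, hy, -⟩ := ex i k hik
    rcases T1 i k l x hik hil hkl hx with h | h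
    · exact ⟨x, hx, h⟩
    · rcases T1 i k l y hik hil hkl hy with h' | h'
      · exact ⟨y, hy, h'⟩
      · have := U i k k l x y hik hkl hxy hx hy h h'
        rw [Sym2.eq_iff] at this; grind
  refine ⟨T3, Adj, ?_⟩
  have other : ∀ i j w, i ≠ j → m w i j → ∃ a, a ≠ w ∧ m a i j ∧ ∀ u, m u i j → u = w ∨ u = a := by
    intro i j w hij hw
    obtain ⟨x, y, hxy, hx, hy, hu⟩ := ex i j hij
    rcases hu w hw with rfl | rfl
    · exact ⟨y, hxy.symm, hy, hu⟩
    · exact ⟨x, hxy, hx, fun u h => (hu u h).symm⟩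
  have star : ∀ i, ∃ w, ∀ j, i ≠ j → m w i j := by
    intro i
    obtain ⟨j, hji, -, -⟩ := exists_fresh hn i i i
    obtain ⟨k, hki, hkj, -⟩ := exists_fresh hn i j j
    obtain ⟨w, hwj, hwk⟩ := Adj i j k hji.symm hki.symm hkj.symm
    refine ⟨w, fun l hil => ?_⟩
    by_cases hlj : l = j
    · rwa [hlj]
    by_cases hlk : l = k
    · rwa [hlk]
    by_contra hwl
    obtain ⟨a, haw, ha, hau⟩ := other i j w hji.symm hwj
    obtain ⟨b, hbw, hb, hbu⟩ := other i k w hki.symm hwk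
    have hab : a ≠ b := by
      rintro rfl
      have := U i j i k a w hji.symm hki.symm haw ha hwj hb hwk
      rw [Sym2.eq_iff] at this; grind
    have hal : m a i l := by
      obtain ⟨v, hv1, hv2⟩ := Adj i j l hji.symm hil (Ne.symm hlj)
      rcases hau v hv1 with rfl | rfl
      · exact absurd hv2 hwl
      · exact hv2
    have hbl : m b i l := by
      obtain ⟨v, hv1, hv2⟩ := Adj i k l hki.symm hil (Ne.symm hlk)
      rcases hbu v hv1 with rfl | rfl
      · exact absurd hv2 hwl
      · exact hv2
    have haj : m a j k := by
      rcases T1 i j k a hji.symm hki.symm hkj.symm ha with h | h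
      · rcases hbu a h with h' | h'
        · exact absurd h' haw
        · exact absurd h' hab
      · exact h
    have hbj : m b j k := by
      rcases T1 i k j b hki.symm hji.symm hkj hb with h | h
      · rcases hau b h with h' | h'
        · exact absurd h' hbw
        · exact absurd h'.symm hab
      · exact sym _ _ _ h
    have := U i l j k a b hil hkj.symm hab hal hbl haj hbj
    rw [Sym2.eq_iff] at this; grind
  choose ρ hρ using star
  refine ⟨ρ, fun i i' h => ?_, hρ⟩
  by_contra hne
  obtain ⟨j, hj1, hj2, -⟩ := exists_fresh hn i i' i'
  have h1 := hρ i i' hne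
  have h2 := hρ i j hj1.symm
  have h3 := hρ i' j hj2.symm
  rw [← h] at h3
  exact T3 i i' j _ hne hj1.symm hj2.symm h1 h2 h3

lemma Y_single (v : Fin n) (e : Edge n) [Decidable (v ∈ e.val)] :
    Y (Pi.single v 1) e = if v ∈ e.val then 1 else 0 := by
  obtain ⟨e, he⟩ := e
  induction e using Sym2.ind with
  | _ i j =>
  have hij : i ≠ j := by simpa using he
  simp only [Y_mk, Sym2.mem_iff, Pi.single_apply]
  by_cases h1 : v = i <;> by_cases h2 : v = j <;> simp_all [eq_comm]

lemma structure_lemma {d : ℕ} (hd : 1 ≤ d) (hn : d + 3 ≤ n) (α : Edge n → ℂ) (hα : ∀ e, α e ≠ 0)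
    (π : Edge n ≃ Edge n) (hA : ∀ y ∈ Mvar d n, (fun e => α e * y (π e)) ∈ Mvar d n) :
    (∀ e e', α e = α e') ∧ ∃ ρ : Equiv.Perm (Fin n), ∀ e, (π e).val = Sym2.map ρ e.val := by
  classical
  let m : Fin n → Fin n → Fin n → Prop := fun v i j =>
    ∃ h : ¬ (s(i, j) : Sym2 (Fin n)).IsDiag, v ∈ (π ⟨s(i, j), h⟩).val
  have hm : ∀ v i j (h : i ≠ j), m v i j ↔ v ∈ (π ⟨s(i, j), by simpa using h⟩).val :=
    fun v i j h => ⟨fun ⟨_, h⟩ => h, fun h' => ⟨_, h'⟩⟩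
  have hco : ∀ v i j, i ≠ j → co (fun e => α e * Y (Pi.single v 1) (π e)) i j =
      if m v i j then co α i j else 0 := by
    intro v i j h
    rw [co_ne _ h, co_ne _ h, Y_single]
    simp only [hm v i j h, mul_ite, mul_one, mul_zero]
  have hF : ∀ v i k l, i ≠ k → i ≠ l → k ≠ l → 4 * (if m v i k then co α i k else 0) *
      (if m v i l then co α i l else 0) = ((if m v i k then co α i k else 0) +
      (if m v i l then co α i l else 0) - (if m v k l then co α k l else 0)) ^ 2 := by
    intro v i k l h1 h2 h3
    have := flat hd hn α hα π hA i k l h1 h2 h3 (Pi.single v 1) _ rfl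
    rwa [hco _ _ _ h1, hco _ _ _ h2, hco _ _ _ h3] at this
  have hα' : ∀ i j, i ≠ j → co α i j ≠ 0 := fun i j h => by rw [co_ne _ h]; exact hα _
  obtain ⟨T3, Adj, ρ, hρi, hρ⟩ := comb (by omega) m
    (by rintro v i j ⟨h, h'⟩
        have : s(i, j) = s(j, i) := Sym2.eq_swap
        exact ⟨this ▸ h, by simpa only [this] using h'⟩)
    (by intro i j h
        obtain ⟨e, he⟩ : ∃ e, e = (π ⟨s(i, j), by simpa using h⟩) := ⟨_, rfl⟩
        have hm' := fun v => hm v i j h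
        rw [← he] at hm'
        obtain ⟨e, hed⟩ := e
        induction e using Sym2.ind with
        | _ x y =>
        refine ⟨x, y, by simpa using hed, ?_, ?_, ?_⟩
        · rw [hm']; simp
        · rw [hm']; simp
        · intro u hu; rw [hm'] at hu; simpa using hu)
    (by intro i j k l v w h1 h2 h3 a1 a2 a3 a4
        rw [hm _ _ _ h1] at a1 a2
        rw [hm _ _ _ h2] at a3 a4
        have e1 := (Sym2.mem_and_mem_iff h3).mp ⟨a1, a2⟩
        have e2 := (Sym2.mem_and_mem_iff h3).mp ⟨a3, a4⟩
        have := π.injective (Subtype.ext (e1.trans e2.symm))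
        exact congrArg Subtype.val this)
    (by intro i k l v h1 h2 h3 hv
        by_contra hc
        push Not at hc
        have := hF v i k l h1 h2 h3
        simp only [hv, hc.1, hc.2, if_true, if_false] at this
        have h4 := hα' i k h1
        simp at this
        exact pow_ne_zero 2 h4 this.symm)
  have hadj : ∀ i k l, i ≠ k → i ≠ l → k ≠ l → co α i k = co α i l := by
    intro i k l h1 h2 h3
    obtain ⟨v, a1, a2⟩ := Adj i k l h1 h2 h3
    have a3 := T3 i k l v h1 h2 h3 a1 a2
    have := hF v i k l h1 h2 h3
    simp only [a1, a2, a3, if_true, if_false] at this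
    have h4 : (co α i k - co α i l) ^ 2 = 0 := by linear_combination -this
    exact sub_eq_zero.mp (pow_eq_zero_iff two_ne_zero |>.mp h4)
  have hadj' : ∀ i k l, i ≠ k → i ≠ l → co α i k = co α i l := by
    intro i k l h1 h2
    by_cases h : k = l
    · rw [h]
    · exact hadj i k l h1 h2 h
  have hsym : ∀ i j, co α i j = co α j i := by
    intro i j; unfold co; simp only [Sym2.eq_swap (a := i) (b := j)]
  constructor
  · rintro ⟨e, he⟩ ⟨e', he'⟩
    induction e using Sym2.ind with
    | _ i j =>
    induction e' using Sym2.ind with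
    | _ k l =>
    have hij : i ≠ j := by simpa using he
    have hkl : k ≠ l := by simpa using he'
    rw [← co_ne α hij, ← co_ne α hkl]
    by_cases h : i = k
    · subst h; exact hadj' _ _ _ hij hkl
    · rw [hadj' i j k hij h, hsym i k, hadj' k i l (Ne.symm h) hkl]
  · refine ⟨Equiv.ofBijective ρ (Finite.injective_iff_bijective.mp hρi), ?_⟩
    rintro ⟨e, he⟩
    induction e using Sym2.ind with
    | _ i j =>
    have hij : i ≠ j := by simpa using he
    have h1 := hρ i j hij
    have h2 := hρ j i hij.symm
    obtain ⟨q1, h1⟩ := h1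
    obtain ⟨q2, h2⟩ := h2
    have hsw : s(j, i) = s(i, j) := Sym2.eq_swap
    simp only [hsw] at h2
    have := (Sym2.mem_and_mem_iff (fun h => hij (hρi h))).mp ⟨h1, h2⟩
    rw [this]; rfl

end AutL

/-- Let `n ≥ d+3`.  Then every linear automorphism `A` of
`L_{d,n}` (a non-singular linear map of `ℂ^N` mapping `L_{d,n}` bijectively to
itself) is a scalar multiple of a signed permutation induced by a vertex
relabeling of `K_n`:  there are a scalar `c ≠ 0`, signs `sgn e ∈ {1,−1}` and a
permutation `σ` of the vertices with `A e f = c · sgn e` when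
`e = Sym2.map σ f`, and `A e f = 0` otherwise. -/
theorem automorphisms_of_L_are_signed_vertex_relabelings
    {d n : ℕ} (hd : 1 ≤ d) (hn : d + 3 ≤ n)
    (A : Matrix (Edge n) (Edge n) ℂ)
    (hunit : IsUnit A.det)
    (haut : (fun x => A.mulVec x) '' Lvar d n = Lvar d n) :
    ∃ (c : ℂ) (sgn : Edge n → ℂ) (σ : Equiv.Perm (Fin n)), c ≠ 0 ∧
      (∀ e, sgn e = 1 ∨ sgn e = -1) ∧
      ∀ e f : Edge n, A e f =
        if (e : Sym2 (Fin n)) = Sym2.map σ (f : Sym2 (Fin n)) then c * sgn e else 0 := by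
  have haut' : ∀ x ∈ Lvar d n, A.mulVec x ∈ Lvar d n := fun x hx => by
    rw [← haut]; exact ⟨x, hx, rfl⟩
  choose π0 hπ0 using AutL.mono_col hd hn A hunit haut'
  have hcol : ∀ f, ¬ ∀ e, A e f = 0 := fun f h => by
    rw [Matrix.det_eq_zero_of_column_eq_zero f h] at hunit
    exact not_isUnit_zero hunit
  have hinj : Function.Injective π0 := by
    intro e e' h
    by_contra hne
    refine hcol (π0 e) fun e'' => ?_
    by_cases h1 : e'' = e
    · rw [h, h1]; exact hπ0 e' e hne
    · exact hπ0 e e'' h1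
  let π : Edge n ≃ Edge n := Equiv.ofBijective π0 (Finite.injective_iff_bijective.mp hinj)
  have hne : ∀ e, A e (π e) ≠ 0 := by
    intro e h
    refine hcol (π0 e) fun e'' => ?_
    by_cases h1 : e'' = e
    · rw [h1]; exact h
    · exact hπ0 e e'' h1
  have hzero : ∀ e f, f ≠ π e → A e f = 0 := by
    intro e f hf
    obtain ⟨e', rfl⟩ := π.surjective f
    exact hπ0 e' e (fun h => hf (by rw [h]))
  have hmul : ∀ x e, A.mulVec x e = A e (π e) * x (π e) := by
    intro x e
    rw [Matrix.mulVec, dotProduct, Finset.sum_eq_single (π e)]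
    · intro f _ hf; rw [hzero e f hf, zero_mul]
    · simp
  obtain ⟨hconst, ρ, hρ⟩ := AutL.structure_lemma hd hn (fun e => A e (π e) ^ 2)
    (fun e => pow_ne_zero _ (hne e)) π (by
      intro y hy
      choose x hx using fun e => IsAlgClosed.exists_pow_nat_eq (y e) zero_lt_two
      have hxy : sqMap x = y := funext hx
      have h1 : x ∈ Lvar d n := by
        show sqMap x ∈ Mvar d n
        rw [hxy]; exact hy
      have h2 : sqMap (A.mulVec x) ∈ Mvar d n := haut' x h1
      convert h2 using 1
      ext e
      simp only [sqMap, hmul, mul_pow, hx])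
  have e0 : Edge n := ⟨s(⟨0, by omega⟩, ⟨1, by omega⟩), by simp⟩
  refine ⟨A e0 (π e0), fun e => A e (π e) / A e0 (π e0), ρ.symm, hne e0, fun e => ?_, fun e f => ?_⟩
  · have h1 : A e (π e) ^ 2 = A e0 (π e0) ^ 2 := hconst e e0
    rcases sq_eq_sq_iff_eq_or_eq_neg.mp h1 with h | h
    · left; show A e (π e) / A e0 (π e0) = 1; rw [h, div_self (hne e0)]
    · right; show A e (π e) / A e0 (π e0) = -1; rw [h, neg_div, div_self (hne e0)]
  · have hiff : (e : Sym2 (Fin n)) = Sym2.map ρ.symm (f : Sym2 (Fin n)) ↔ f = π e := by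
      rw [Subtype.ext_iff, hρ]
      constructor
      · intro h; rw [h, Sym2.map_map]; simp
      · intro h; rw [h, Sym2.map_map]; simp
    by_cases h : f = π e
    · rw [if_pos (hiff.mpr h), mul_div_cancel₀ _ (hne e0), h]
    · rw [if_neg (fun h' => h (hiff.mp h')), hzero e f h]
end

section
/- Let d ≥ 3. Then every linear automorphism A of L_{d,d+2} is a scalar multiple of a signed permutation that is induced by a vertex relabeling of K_{d+2}. -/
open Polynomial in
theorem natDegree_det_le_weights {R : Type*} [CommRing R] {n : ℕ}
    (M : Matrix (Fin n) (Fin n) R[X]) (r c : Fin n → ℕ)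
    (h : ∀ i j, (M i j).natDegree ≤ r i + c j) :
    M.det.natDegree ≤ ∑ i, r i + ∑ i, c i := by
  rw [Matrix.det_apply]
  refine Polynomial.natDegree_sum_le_of_forall_le _ _ fun σ _ => ?_
  refine (Polynomial.natDegree_smul_le _ _).trans ?_
  refine (Polynomial.natDegree_prod_le _ _).trans ?_
  refine (Finset.sum_le_sum fun i _ => h (σ i) i).trans ?_
  rw [Finset.sum_add_distrib, Equiv.sum_comp σ r]

section basics
variable {R : Type*} [CommRing R] {n m : ℕ}

/-- matrix of squared lengths -/
def Ym (w : Sym2 (Fin n) → R) : Matrix (Fin n) (Fin n) R :=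
  Matrix.of fun i j => if i = j then 0 else w s(i, j) ^ 2

/-- all `c` matrix -/
def Jm (n : ℕ) (c : R) : Matrix (Fin n) (Fin n) R := Matrix.of fun _ _ => c

/-- Cayley-Menger type polynomial -/
def FF (w : Sym2 (Fin n) → R) : R := (Ym w + Jm n 1).det - (Ym w + Jm n 0).det

/-- Gram type matrix -/
def Km (w : Sym2 (Fin (m + 1)) → R) : Matrix (Fin m) (Fin m) R :=
  Matrix.of fun i j => Ym w i.succ j.succ - Ym w 0 j.succ - Ym w i.succ 0

theorem Ym_map {S : Type*} [CommRing S] (φ : R →+* S) (w : Sym2 (Fin n) → R) (i j : Fin n) :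
    Ym (fun e => φ (w e)) i j = φ (Ym w i j) := by
  simp only [Ym, Matrix.of_apply]
  split_ifs <;> simp

theorem FF_map {S : Type*} [CommRing S] (φ : R →+* S) (w : Sym2 (Fin n) → R) :
    FF (fun e => φ (w e)) = φ (FF w) := by
  unfold FF
  rw [map_sub, RingHom.map_det, RingHom.map_det]
  congr 2 <;>
  · ext i j
    simp [Ym_map, Jm]

theorem FF_perm (σ : Equiv.Perm (Fin n)) (w : Sym2 (Fin n) → R) :
    FF (fun e => w (e.map σ)) = FF w := by
  unfold FF
  rw [← Matrix.det_submatrix_equiv_self σ (Ym w + Jm n 1),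
    ← Matrix.det_submatrix_equiv_self σ (Ym w + Jm n 0)]
  congr 2 <;>
  · ext i j
    simp [Ym, Jm]

theorem FF_congr (w w' : Sym2 (Fin n) → R) (h : ∀ e, ¬ e.IsDiag → w e = w' e) : FF w = FF w' := by
  have : Ym w = Ym w' := by
    ext i j
    simp only [Ym, Matrix.of_apply]
    split_ifs with hij
    · rfl
    · rw [h]; simpa using hij
  simp [FF, this]

/-- auxiliary -/
def Nm (w : Sym2 (Fin (m + 1)) → R) (c : R) : Matrix (Fin (m + 1)) (Fin (m + 1)) R :=
  Matrix.of (Fin.cons (Fin.cons c fun j => Ym w 0 j.succ)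
    fun i => Fin.cons (Ym w i.succ 0) fun j => Km w i j)

theorem det_Nm (w : Sym2 (Fin (m + 1)) → R) (c : R) :
    (Ym w + Jm (m+1) c).det = (Nm w c).det := by
  have h0 : Ym w 0 0 = 0 := by simp [Ym]
  let B : Matrix (Fin (m+1)) (Fin (m+1)) R :=
    Matrix.of (Fin.cons (fun j => Ym w 0 j + c)
      fun i => fun j => Ym w i.succ j - Ym w 0 j)
  have h1 : (Ym w + Jm (m+1) c).det = B.det := by
    refine Matrix.det_eq_of_forall_row_eq_smul_add_const (Fin.cons 0 fun _ => 1) 0 (by simp) ?_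
    intro i j
    refine Fin.cases ?_ (fun i => ?_) i
    · simp [B, Jm]
    · simp [B, Jm]; ring
  rw [h1, ← Matrix.det_transpose, ← Matrix.det_transpose (Nm w c)]
  refine Matrix.det_eq_of_forall_row_eq_smul_add_const (Fin.cons 0 fun _ => 1) 0 (by simp) ?_
  intro i j
  refine Fin.cases ?_ (fun i => ?_) i <;> refine Fin.cases ?_ (fun j => ?_) j
  · simp [B, Nm, h0]
  · simp [B, Nm, h0]
  · simp [B, Nm]
  · simp [B, Nm, Km]; 

theorem FF_eq_det (w : Sym2 (Fin (m + 1)) → R) : FF w = (Km w).det := by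
  unfold FF
  rw [det_Nm, det_Nm, Matrix.det_succ_row_zero, Matrix.det_succ_row_zero, Fin.sum_univ_succ,
    Fin.sum_univ_succ]
  have e : ∀ (c : R) (k : Fin (m+1)), (Nm w c).submatrix Fin.succ k.succAbove
      = (Nm w 0).submatrix Fin.succ k.succAbove := by
    intro c k
    ext i j
    simp [Nm]
  simp only [e 1]
  have : (Nm w 0).submatrix Fin.succ (Fin.succAbove 0) = Km w := by
    ext i j
    simp [Nm]
  rw [this]
  simp [Nm]

/-- shift by two -/
def ss (i : Fin n) : Fin (n + 2) := i.succ.succ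

theorem det_swap_rows (M : Matrix (Fin (n + 2)) (Fin (n + 2)) R) :
    ((M.updateRow 0 (Pi.single 1 1)).updateRow 1 (Pi.single 0 1)).det
      = - (M.submatrix ss ss).det := by
  rw [Matrix.det_succ_row_zero, Fin.sum_univ_succ, Fin.sum_univ_succ]
  rw [Matrix.det_succ_row_zero (Matrix.submatrix _ _ _),
    Matrix.det_succ_row_zero (Matrix.submatrix _ _ (Fin.succAbove (Fin.succ 0))), Fin.sum_univ_succ,
    Fin.sum_univ_succ]
  have h1 : ∀ x : Fin n, (1 : Fin (n+2)) ≠ x.succ.succ := by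
    intro x h
    have := congrArg Fin.val h
    simp at this
  simp [Matrix.updateRow_apply, Pi.single_apply, Fin.succ_ne_zero]
  rw [Finset.sum_eq_zero (fun x _ => if_neg (h1 x).symm), add_zero]
  congr 2

theorem det_two_rows (M M' : Matrix (Fin (n + 2)) (Fin (n + 2)) R) (y : R)
    (h : ∀ i j, M' i j = M i j + (if (i = 0 ∧ j = 1) ∨ (i = 1 ∧ j = 0) then y else 0)) :
    M'.det = - y ^ 2 * (M.submatrix ss ss).det +
      y * ((M.updateRow 1 (Pi.single 0 1)).det + (M.updateRow 0 (Pi.single 1 1)).det) + M.det := by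
  have hM : M' = (M.updateRow 0 (M 0 + y • Pi.single 1 1)).updateRow 1 (M 1 + y • Pi.single 0 1) := by
    ext i j
    rw [h]
    by_cases h1 : i = 1
    · subst h1
      simp [Pi.single_apply]
    · by_cases h0 : i = 0
      · subst h0
        simp [Pi.single_apply]
      · simp [h0, h1]
  have hne : (0 : Fin (n+2)) ≠ 1 := by simp
  rw [hM, Matrix.det_updateRow_add, Matrix.det_updateRow_smul,
    Matrix.updateRow_comm _ hne, Matrix.updateRow_comm _ hne, 
    Matrix.det_updateRow_add, Matrix.det_updateRow_smul, Matrix.det_updateRow_add,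
    Matrix.det_updateRow_smul, Matrix.updateRow_comm _ hne.symm, Matrix.updateRow_comm _ hne.symm,
    Matrix.updateRow_comm _ hne.symm, Matrix.updateRow_comm _ hne.symm]
  have e1 : (M.updateRow 0 (M 0)) = M := Matrix.updateRow_eq_self M 0
  have e2 : (M.updateRow 1 (M 1)) = M := Matrix.updateRow_eq_self M 1
  rw [det_swap_rows, e1, e2, Matrix.updateRow_comm _ hne, e2]
  ring

theorem FF_drop (w : Sym2 (Fin (n + 2)) → R) :
    ∃ β γ : R, ∀ s : R, FF (Function.update w s(0, 1) s) =
      - s ^ 4 * FF (fun e => w (e.map ss)) + s ^ 2 * β + γ := by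
  have key : ∀ c : R, ∃ β γ : R, ∀ s : R,
      (Ym (Function.update w s(0, 1) s) + Jm _ c).det =
      - s ^ 4 * (Ym (fun e : Sym2 (Fin n) => w (e.map ss)) + Jm _ c).det
        + s ^ 2 * β + γ := by
    intro c
    let M := Ym (Function.update w s(0, 1) 0) + Jm _ c
    refine ⟨((M.updateRow 1 (Pi.single 0 1)).det + (M.updateRow 0 (Pi.single 1 1)).det), M.det,
      fun s => ?_⟩
    rw [det_two_rows M _ (s ^ 2)]
    · have : M.submatrix ss ss = (Ym (fun e : Sym2 (Fin n) => w (e.map ss)) + Jm _ c) := by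
        ext i j
        have h1 : (j.succ.succ : Fin (n+2)) ≠ 1 := by
          intro h
          have := congrArg Fin.val h
          simp at this
        simp [M, Ym, Jm, ss, Function.update_apply, Fin.succ_ne_zero]
      rw [this]; ring
    · intro i j
      simp only [M, Ym, Jm, Matrix.add_apply, Matrix.of_apply, Function.update_apply]
      have : (s(i, j) = s(0, 1)) ↔ ((i = 0 ∧ j = 1) ∨ (i = 1 ∧ j = 0)) := by simp
      simp only [this]
      by_cases hij : i = j
      · subst hij
        have : ¬ ((i = 0 ∧ i = 1) ∨ (i = 1 ∧ i = 0)) := by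
          rintro (⟨h, h'⟩ | ⟨h, h'⟩) <;> rw [h] at h' <;> simp at h'
        rw [if_pos rfl, if_pos rfl, if_neg this]; simp
      · split_ifs <;> simp [add_comm]
  obtain ⟨β, γ, h⟩ := key 1
  obtain ⟨β', γ', h'⟩ := key 0
  refine ⟨β - β', γ - γ', fun s => ?_⟩
  unfold FF
  rw [h, h']
  ring

end basics


open Polynomial in
/-- degree along the direction `v` is at most `k` -/
def Dg (k : ℕ) {n : ℕ} (v : Sym2 (Fin n) → ℂ) : Prop :=
  ∀ x : Sym2 (Fin n) → ℂ, (FF (fun e => C (x e) + X * C (v e))).natDegree ≤ k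

theorem Dg_perm {k n : ℕ} {v : Sym2 (Fin n) → ℂ} (h : Dg k v) (σ : Equiv.Perm (Fin n)) :
    Dg k (fun e => v (e.map σ)) := by
  intro x
  have := h (fun e => x (e.map σ.symm))
  rw [← FF_perm σ] at this
  simpa [Sym2.map_map] using this

theorem ss_inj {n : ℕ} : Function.Injective (ss : Fin n → Fin (n+2)) := by
  intro a b h
  simpa [ss] using h

theorem ss_ne0 {n : ℕ} (i : Fin n) : ss i ≠ 0 := by
  simp [ss, Fin.succ_ne_zero]

theorem ss_ne1 {n : ℕ} (i : Fin n) : ss i ≠ 1 := by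
  intro h
  have := congrArg Fin.val h
  simp [ss] at this

theorem ss_surj {n : ℕ} (i : Fin (n+2)) (h0 : i ≠ 0) (h1 : i ≠ 1) : ∃ j : Fin n, ss j = i := by
  refine ⟨⟨i.val - 2, ?_⟩, ?_⟩
  · have := i.2
    have : i.val ≠ 0 := fun h => h0 (Fin.ext h)
    have : i.val ≠ 1 := fun h => h1 (Fin.ext h)
    omega
  · have : i.val ≠ 0 := fun h => h0 (Fin.ext h)
    have : i.val ≠ 1 := fun h => h1 (Fin.ext h)
    ext
    simp [ss]; omega

open Polynomial in
theorem Dg_drop_aux {k n : ℕ} {v : Sym2 (Fin (n + 2)) → ℂ} (h : Dg k v) (x : Sym2 (Fin n) → ℂ) :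
    (FF (fun e => C (x e) + X * C (v (e.map ss)))).natDegree ≤ k ∧
    (X * C (v s(0,1)) * (FF (fun e => C (x e) + X * C (v (e.map ss))))).natDegree ≤ k := by
  let x' : Sym2 (Fin (n+2)) → ℂ := Function.extend (Sym2.map ss) x 0
  have hx' : ∀ e, x' (e.map ss) = x e := fun e =>
    (Sym2.map.injective ss_inj).extend_apply _ _ _
  obtain ⟨β, γ, hd⟩ := FF_drop (fun e => C (x' e) + X * C (v e))
  simp only [hx'] at hd
  set P := FF (fun e => C (x e) + X * C (v (e.map ss))) with hP
  let g : ℂ → ℂ[X] := fun s => - (C s + X * C (v s(0,1)))^4 * P + (C s + X * C (v s(0,1)))^2 * β + γ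
  have hg : ∀ s, g s ∈ degreeLE ℂ k := by
    intro s
    rw [mem_degreeLE, ← natDegree_le_iff_degree_le]
    have := h (Function.update x' s(0,1) s)
    convert this using 2
    simp only [g]
    rw [← hd]
    congr 1
    ext1 e
    by_cases he : e = s(0,1)
    · subst he; simp
    · simp [he]
  constructor
  · have : P = C (-1/24 : ℂ) * (g 2 - C 4 * g 1 + C 6 * g 0 - C 4 * g (-1) + g (-2)) := by
      have e : (g 2 - C 4 * g 1 + C 6 * g 0 - C 4 * g (-1) + g (-2)) = C (-24) * P := by
        simp only [g, map_neg, map_zero, map_one, map_ofNat]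
        ring
      rw [e, ← mul_assoc, ← C_mul]; norm_num
    have h2 : P ∈ degreeLE ℂ k := by
      rw [this]
      simp only [← smul_eq_C_mul]
      exact Submodule.smul_mem _ _ (Submodule.add_mem _ (Submodule.sub_mem _ (Submodule.add_mem _
        (Submodule.sub_mem _ (hg _) (Submodule.smul_mem _ _ (hg _)))
          (Submodule.smul_mem _ _ (hg _))) (Submodule.smul_mem _ _ (hg _))) (hg _))
    rwa [mem_degreeLE, ← natDegree_le_iff_degree_le] at h2
  · have : X * C (v s(0,1)) * P = C (-1/48 : ℂ) * (g 2 - C 2 * g 1 + C 2 * g (-1) - g (-2)) := by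
      have e : (g 2 - C 2 * g 1 + C 2 * g (-1) - g (-2)) = C (-48) * (X * C (v s(0,1)) * P) := by
        simp only [g, map_neg, map_one, map_ofNat]
        ring
      rw [e, ← mul_assoc, ← C_mul]; norm_num
    have h2 : X * C (v s(0,1)) * P ∈ degreeLE ℂ k := by
      rw [this]
      simp only [← smul_eq_C_mul]
      exact Submodule.smul_mem _ _ (Submodule.sub_mem _ (Submodule.add_mem _
        (Submodule.sub_mem _ (hg _) (Submodule.smul_mem _ _ (hg _)))
          (Submodule.smul_mem _ _ (hg _))) (hg _))
    rwa [mem_degreeLE, ← natDegree_le_iff_degree_le] at h2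

open Polynomial in
theorem Dg_drop {k n : ℕ} {v : Sym2 (Fin (n + 2)) → ℂ} (h : Dg k v) :
    Dg k (fun e => v (e.map ss)) := fun x => (Dg_drop_aux h x).1

open Polynomial in
theorem Dg_drop' {k n : ℕ} {v : Sym2 (Fin (n + 2)) → ℂ} (h : Dg (k+1) v) (h0 : v s(0,1) ≠ 0) :
    Dg k (fun e => v (e.map ss)) := by
  intro x
  have := (Dg_drop_aux h x).2
  set P := FF (fun e => C (x e) + X * C (v (e.map ss))) with hP
  by_cases hz : P = 0
  · simp [hz]
  · rw [natDegree_mul (by simpa using h0) hz, natDegree_mul (by simp) (by simpa using h0)] at this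
    simp at this
    omega

theorem exists_perm_pair {n : ℕ} (p q : Fin (n+2)) (h : p ≠ q) :
    ∃ σ : Equiv.Perm (Fin (n+2)), σ 0 = p ∧ σ 1 = q := by
  refine ⟨(Equiv.swap 0 p).trans (Equiv.swap (Equiv.swap 0 p 1) q), ?_, ?_⟩
  · have h1 : p ≠ Equiv.swap 0 p 1 := by
      intro h
      have := congrArg (Equiv.swap 0 p) h
      simp at this
    simp [Equiv.swap_apply_of_ne_of_ne h1 h]
  · simp

theorem Dg_drop_pair {k n : ℕ} {v : Sym2 (Fin (n + 2)) → ℂ} (h : Dg (k+1) v) (p q : Fin (n+2))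
    (hpq : p ≠ q) : ∃ φ : Fin n → Fin (n+2), Function.Injective φ ∧
      (∀ i, i ≠ p → i ≠ q → ∃ j, φ j = i) ∧ Dg (k+1) (fun e => v (e.map φ)) ∧
      (v s(p,q) ≠ 0 → Dg k (fun e => v (e.map φ))) := by
  obtain ⟨σ, h0, h1⟩ := exists_perm_pair p q hpq
  refine ⟨σ ∘ ss, σ.injective.comp ss_inj, ?_, ?_, ?_⟩
  · intro i hp hq
    obtain ⟨j, hj⟩ := ss_surj (σ.symm i) (fun h => hp (by rw [← h0, ← h]; simp))
      (fun h => hq (by rw [← h1, ← h]; simp))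
    exact ⟨j, by simp [hj]⟩
  · simpa [Sym2.map_map] using Dg_drop (Dg_perm h σ)
  · intro hv
    simpa [Sym2.map_map] using Dg_drop' (Dg_perm h σ) (by simpa [h0, h1] using hv)


open Polynomial in
theorem Dg1_two {v : Sym2 (Fin 2) → ℂ} (h : Dg 1 v) : v s(0,1) = 0 := by
  have := h 0
  have e : FF (fun e => C ((0 : Sym2 (Fin 2) → ℂ) e) + X * C (v e)) = C (-2 * v s(0,1)^2) * X^2 := by
    rw [FF_eq_det]
    simp [Km, Ym, Sym2.eq_swap (a := (1 : Fin 2)) (b := 0)]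
    simp only [map_ofNat]
    ring
  rw [e] at this
  have h2 := coeff_eq_zero_of_natDegree_lt (n := 2) (lt_of_le_of_lt this (by norm_num))
  rw [coeff_C_mul, coeff_X_pow] at h2
  simpa using h2

open Polynomial in
theorem FF_three (R : Type*) [CommRing R] (w : Sym2 (Fin 3) → R) : FF w =
    4 * w s(0,1)^2 * w s(0,2)^2 - (w s(1,2)^2 - w s(0,1)^2 - w s(0,2)^2)^2 := by
  rw [FF_eq_det, Matrix.det_fin_two]
  simp [Km, Ym, Sym2.eq_swap (a := (1 : Fin 3)) (b := 0), Sym2.eq_swap (a := (2 : Fin 3)) (b := 0),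
    Sym2.eq_swap (a := (2 : Fin 3)) (b := 1)]
  ring

theorem FF_four (R : Type*) [CommRing R] (w : Sym2 (Fin 4) → R) : FF w =
    (Matrix.of ![![-2 * w s(0,1)^2, w s(1,2)^2 - w s(0,1)^2 - w s(0,2)^2,
        w s(1,3)^2 - w s(0,1)^2 - w s(0,3)^2],
      ![w s(1,2)^2 - w s(0,1)^2 - w s(0,2)^2, -2 * w s(0,2)^2, 
        w s(2,3)^2 - w s(0,2)^2 - w s(0,3)^2],
      ![w s(1,3)^2 - w s(0,1)^2 - w s(0,3)^2, w s(2,3)^2 - w s(0,2)^2 - w s(0,3)^2,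
        -2 * w s(0,3)^2]]).det := by
  rw [FF_eq_det, Matrix.det_fin_three, Matrix.det_fin_three]
  have h2 : Fin.succ (2 : Fin 3) = 3 := rfl
  simp [Km, Ym, Sym2.eq_swap (a := (1 : Fin 4)) (b := 0), Sym2.eq_swap (a := (2 : Fin 4)) (b := 0),
    Sym2.eq_swap (a := (3 : Fin 4)) (b := 0), Sym2.eq_swap (a := (3 : Fin 4)) (b := 1),
    Sym2.eq_swap (a := (3 : Fin 4)) (b := 2), h2,
    Sym2.eq_swap (a := (2 : Fin 4)) (b := 1)]
  ring

open Polynomial in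
theorem three_coeffs (v : Sym2 (Fin 3) → ℂ) : ∃ r : ℂ[X], 
    FF (fun e => C ((Pi.single s(0,1) 1 : Sym2 (Fin 3) → ℂ) e) + X * C (v e)) =
    C (-1) + C (-4 * v s(0,1)) * X + C (-6 * v s(0,1)^2 + 2 * (v s(0,2)^2 + v s(1,2)^2)) * X ^ 2
    + C (4 * v s(0,1) * (v s(0,2)^2 + v s(1,2)^2 - v s(0,1)^2)) * X ^ 3 + r * X ^ 4 := by
  refine ⟨C (4 * v s(0,1)^2 * v s(0,2)^2 - (v s(1,2)^2 - v s(0,1)^2 - v s(0,2)^2)^2), ?_⟩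
  have h1 : (s(0,2) : Sym2 (Fin 3)) ≠ s(0,1) := by decide
  have h2 : (s(1,2) : Sym2 (Fin 3)) ≠ s(0,1) := by decide
  rw [FF_three]
  simp only [Pi.single_eq_same, Pi.single_eq_of_ne h1, Pi.single_eq_of_ne h2]
  simp only [map_add, map_sub, map_mul, map_neg, map_pow, map_one, map_zero, map_ofNat]
  ring

open Polynomial in
theorem Dg1_three_aux {v : Sym2 (Fin 3) → ℂ} (h : Dg 1 v) :
   -6 * v s(0,1)^2 + 2 * (v s(0,2)^2 + v s(1,2)^2) = 0 := by
  obtain ⟨r, hr⟩ := three_coeffs v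
  have := h (Pi.single s(0,1) 1)
  rw [hr] at this
  have h2 := coeff_eq_zero_of_natDegree_lt (n := 2) (lt_of_le_of_lt this (by norm_num))
  simpa [coeff_X, coeff_C, coeff_mul_X_pow', -map_add, -map_neg, -map_mul] using h2

open Polynomial in
theorem Dg2_three_aux {v : Sym2 (Fin 3) → ℂ} (h : Dg 2 v) :
   v s(0,1) * (v s(0,2)^2 + v s(1,2)^2 - v s(0,1)^2) = 0 := by
  obtain ⟨r, hr⟩ := three_coeffs v
  have := h (Pi.single s(0,1) 1)
  rw [hr] at this
  have h2 := coeff_eq_zero_of_natDegree_lt (n := 3) (lt_of_le_of_lt this (by norm_num))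
  simpa [coeff_X, coeff_C, coeff_mul_X_pow', -map_add, -map_neg, -map_mul, -map_sub] using h2

theorem Dg1_three {v : Sym2 (Fin 3) → ℂ} (h : Dg 1 v) : v s(0,1) = 0 := by
  have h1 := Dg1_three_aux h
  have h2 := Dg1_three_aux (Dg_perm h (Equiv.swap 0 2))
  have h3 := Dg1_three_aux (Dg_perm h (Equiv.swap 1 2))
  have e1 : Equiv.swap (0 : Fin 3) 2 1 = 1 := by decide
  have e2 : Equiv.swap (1 : Fin 3) 2 0 = 0 := by decide
  simp [e1, e2, Sym2.eq_swap (a := (1 : Fin 3)) (b := 0), Sym2.eq_swap (a := (2 : Fin 3)) (b := 0),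
    Sym2.eq_swap (a := (2 : Fin 3)) (b := 1)] at h2 h3
  have : v s(0,1)^2 = 0 := by linear_combination (-1/4) * h1 - (1/8) * h2 - (1/8) * h3
  simpa using this

/-- triangle condition -/
def Tri (a b c : ℂ) : Prop := a * b * c = 0 ∧ (c = 0 → a ^ 2 = b ^ 2)

theorem Dg2_three {v : Sym2 (Fin 3) → ℂ} (h : Dg 2 v) : Tri (v s(0,1)) (v s(0,2)) (v s(1,2)) := by
  have h1 := Dg2_three_aux h
  have h2 := Dg2_three_aux (Dg_perm h (Equiv.swap 0 2))
  have h3 := Dg2_three_aux (Dg_perm h (Equiv.swap 1 2))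
  have e1 : Equiv.swap (0 : Fin 3) 2 1 = 1 := by decide
  have e2 : Equiv.swap (1 : Fin 3) 2 0 = 0 := by decide
  simp [e1, e2, Sym2.eq_swap (a := (1 : Fin 3)) (b := 0), Sym2.eq_swap (a := (2 : Fin 3)) (b := 0),
    Sym2.eq_swap (a := (2 : Fin 3)) (b := 1), -mul_eq_zero] at h1 h2 h3
  constructor
  · by_contra hne
    have ha : v s(0,1) ≠ 0 := by rintro h; simp [h] at hne
    have hb : v s(0,2) ≠ 0 := by rintro h; simp [h] at hne
    have hc : v s(1,2) ≠ 0 := by rintro h; simp [h] at hne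
    have h1 := (mul_eq_zero.1 h1).resolve_left ha
    have h2 := (mul_eq_zero.1 h2).resolve_left hc
    have : v s(0,2)^2 = 0 := by linear_combination (1/2) * h1 + (1/2) * h2
    exact hb (by simpa using this)
  · intro hc
    rw [hc] at h1 h2 h3
    rcases mul_eq_zero.1 h1 with h1 | h1
    · rw [h1] at h3 ⊢
      have : v s(0,2)^3 = 0 := by linear_combination -h3
      simp at this
      simp [this]
    · linear_combination -h1

open Polynomial in
theorem four_coeffs (v : Sym2 (Fin 4) → ℂ) : ∃ r : ℂ[X], ∃ q2 q3 : ℂ,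
    FF (fun e => C ((Pi.single s(0,3) 1 : Sym2 (Fin 4) → ℂ) e) + X * C (v e)) =
    C q2 * X ^ 2 + C q3 * X ^ 3 +
    C (-2 * (-6 * v s(0,3)^2 * v s(1,2)^2 + (v s(1,2)^2 * (v s(0,1)^2 + v s(0,2)^2 + v s(1,3)^2
      + v s(2,3)^2 - v s(1,2)^2) + (v s(0,1)^2 - v s(0,2)^2) * (v s(2,3)^2 - v s(1,3)^2)))) * X ^ 4
    + r * X ^ 5 := by
  set a := v s(0,1) with ha
  set b := v s(0,2) with hb
  set c := v s(0,3) with hc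
  set d := v s(1,2) with hd
  set e := v s(1,3) with he
  set f := v s(2,3) with hf
  let L := d^2 * (a^2+b^2+e^2+f^2-d^2) + (a^2-b^2)*(f^2-e^2)
  let E0 := a^2*f^2*(b^2+d^2+e^2-a^2-f^2) + b^2*e^2*(a^2+d^2+f^2-b^2-e^2) - a^2*b^2*d^2 - d^2*e^2*f^2
  refine ⟨C (-2) * (- C (4 * c^3*d^2) - C (c^4*d^2) * X + C (2*c*L) + C (c^2 * L) * X + C E0 * X),
    2 * d^2, 8 * c * d^2, ?_⟩
  have h1 : (s(0,1) : Sym2 (Fin 4)) ≠ s(0,3) := by decide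
  have h2 : (s(0,2) : Sym2 (Fin 4)) ≠ s(0,3) := by decide
  have h3 : (s(1,2) : Sym2 (Fin 4)) ≠ s(0,3) := by decide
  have h4 : (s(1,3) : Sym2 (Fin 4)) ≠ s(0,3) := by decide
  have h5 : (s(2,3) : Sym2 (Fin 4)) ≠ s(0,3) := by decide
  rw [FF_four, Matrix.det_fin_three]
  simp [Pi.single_eq_same, Pi.single_eq_of_ne h1, Pi.single_eq_of_ne h2, Pi.single_eq_of_ne h3,
    Pi.single_eq_of_ne h4, Pi.single_eq_of_ne h5, ← ha, ← hb, ← hc, ← hd, ← he, ← hf, L, E0]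
  simp only [map_ofNat]
  ring

open Polynomial in
theorem Dg2_four_aux {v : Sym2 (Fin 4) → ℂ} (h : Dg 2 v) :
   (-6 * v s(0,3)^2 * v s(1,2)^2 + (v s(1,2)^2 * (v s(0,1)^2 + v s(0,2)^2 + v s(1,3)^2
      + v s(2,3)^2 - v s(1,2)^2) + (v s(0,1)^2 - v s(0,2)^2) * (v s(2,3)^2 - v s(1,3)^2))) = 0 := by
  obtain ⟨r, q2, q3, hr⟩ := four_coeffs v
  have := h (Pi.single s(0,3) 1)
  rw [hr] at this
  have h2 := coeff_eq_zero_of_natDegree_lt (n := 4) (lt_of_le_of_lt this (by norm_num))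
  simpa [coeff_X, coeff_C, coeff_mul_X_pow', -map_add, -map_neg, -map_mul, -map_sub] using h2

theorem Dg2_four_disj {v : Sym2 (Fin 4) → ℂ} (h : Dg 2 v) : v s(0,1) * v s(2,3) = 0 := by
  by_cases h0 : v s(0,1) = 0
  · simp [h0]
  · have := Dg1_two (Dg_drop' h h0)
    have e : v s(2,3) = 0 := by simpa [ss] using this
    simp [e]

theorem alg_four (A B Cc D E F : ℂ) (h1 : A * F = 0) (h2 : B * E = 0) (h3 : Cc * D = 0)
    (e03 : D * (A + B + E + F - D) + (A - B) * (F - E) = 0)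
    (e12 : Cc * (A + B + E + F - Cc) + (A - E) * (F - B) = 0)
    (e01 : F * (B + Cc + D + E - F) + (B - Cc) * (E - D) = 0)
    (e23 : A * (B + Cc + D + E - A) + (B - D) * (E - Cc) = 0)
    (e02 : E * (A + Cc + D + F - E) + (A - Cc) * (F - D) = 0)
    (e13 : B * (A + Cc + D + F - B) + (A - D) * (F - Cc) = 0) :
    A * B * D = 0 ∧ (D = 0 → A = B) := by
  constructor
  · grind
  · intro hD
    subst hD
    grind


theorem Dg2_four {v : Sym2 (Fin 4) → ℂ} (h : Dg 2 v) : Tri (v s(0,1)) (v s(0,2)) (v s(1,2)) := by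
  have w10 : (s(1,0) : Sym2 (Fin 4)) = s(0,1) := Sym2.eq_swap
  have w20 : (s(2,0) : Sym2 (Fin 4)) = s(0,2) := Sym2.eq_swap
  have w30 : (s(3,0) : Sym2 (Fin 4)) = s(0,3) := Sym2.eq_swap
  have w21 : (s(2,1) : Sym2 (Fin 4)) = s(1,2) := Sym2.eq_swap
  have w31 : (s(3,1) : Sym2 (Fin 4)) = s(1,3) := Sym2.eq_swap
  have w32 : (s(3,2) : Sym2 (Fin 4)) = s(2,3) := Sym2.eq_swap
  have key : ∀ (a b c d : Fin 4) (σ : Equiv.Perm (Fin 4)), σ 0 = a → σ 1 = b → σ 2 = c → σ 3 = d →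
      (v s(a,b) * v s(c,d) = 0 ∧
      (-6 * v s(a,d)^2 * v s(b,c)^2 + (v s(b,c)^2 * (v s(a,b)^2 + v s(a,c)^2 + v s(b,d)^2
      + v s(c,d)^2 - v s(b,c)^2) + (v s(a,b)^2 - v s(a,c)^2) * (v s(c,d)^2 - v s(b,d)^2))) = 0) := by
    rintro a b c d σ rfl rfl rfl rfl
    exact ⟨by simpa using Dg2_four_disj (Dg_perm h σ), by simpa using Dg2_four_aux (Dg_perm h σ)⟩
  have k1 := key 0 1 2 3 1 rfl rfl rfl rfl
  have k2 := key 0 2 1 3 (Equiv.swap 1 2) (by decide) (by decide) (by decide) (by decide)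
  have k3 := key 0 3 2 1 (Equiv.swap 1 3) (by decide) (by decide) (by decide) (by decide)
  have k4 := key 1 0 3 2 (Equiv.swap 0 1 * Equiv.swap 2 3) (by decide) (by decide) (by decide) (by decide)
  have k5 := key 0 1 3 2 (Equiv.swap 2 3) (by decide) (by decide) (by decide) (by decide)
  have k6 := key 1 0 2 3 (Equiv.swap 0 1) (by decide) (by decide) (by decide) (by decide)
  have k7 := key 2 0 1 3 (Equiv.swap 1 2 * Equiv.swap 0 1) (by decide) (by decide) (by decide) (by decide)
  simp only [w10, w20, w30, w21, w31, w32] at k1 k2 k3 k4 k5 k6 k7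
  obtain ⟨d1, e03⟩ := k1
  obtain ⟨d2, -⟩ := k2
  obtain ⟨d3, e01⟩ := k3
  obtain ⟨-, e12⟩ := k4
  obtain ⟨-, e02⟩ := k5
  obtain ⟨-, e13⟩ := k6
  obtain ⟨-, e23⟩ := k7
  have := alg_four (v s(0,1)^2) (v s(0,2)^2) (v s(0,3)^2) (v s(1,2)^2) (v s(1,3)^2) (v s(2,3)^2)
    (by rw [← mul_pow, d1]; simp) (by rw [← mul_pow, d2]; simp)
    (by rw [← mul_pow, d3]; simp)
    (by linear_combination e03 + 6 * v s(0,3) * v s(1,2) * d3)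
    (by linear_combination e12 + 6 * v s(0,3) * v s(1,2) * d3)
    (by linear_combination e01 + 6 * v s(0,1) * v s(2,3) * d1)
    (by linear_combination e23 + 6 * v s(0,1) * v s(2,3) * d1)
    (by linear_combination e02 + 6 * v s(0,2) * v s(1,3) * d2)
    (by linear_combination e13 + 6 * v s(0,2) * v s(1,3) * d2)
  refine ⟨?_, fun h => this.2 (by simp [h])⟩
  have h2 := this.1
  rw [← mul_pow, ← mul_pow] at h2
  exact pow_eq_zero_iff (two_ne_zero) |>.1 h2


theorem exists_two {n : ℕ} (S : Finset (Fin n)) (h : S.card + 2 ≤ n) :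
    ∃ p q, p ≠ q ∧ p ∉ S ∧ q ∉ S := by
  have : 1 < Sᶜ.card := by
    rw [Finset.card_compl, Fintype.card_fin]; omega
  obtain ⟨p, hp, q, hq, hpq⟩ := Finset.one_lt_card.1 this
  exact ⟨p, q, hpq, by simpa using hp, by simpa using hq⟩

theorem Dg1_all : ∀ (n : ℕ) (v : Sym2 (Fin n) → ℂ), Dg 1 v → ∀ i j, i ≠ j → v s(i,j) = 0
  | 0, _, _, i, _, _ => i.elim0
  | 1, _, _, i, j, hij => absurd (Subsingleton.elim i j) hij
  | 2, v, h, i, j, hij => by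
    obtain ⟨σ, h0, h1⟩ := exists_perm_pair i j hij
    have := Dg1_two (Dg_perm h σ)
    simpa [h0, h1] using this
  | 3, v, h, i, j, hij => by
    obtain ⟨σ, h0, h1⟩ := exists_perm_pair i j hij
    have := Dg1_three (Dg_perm h σ)
    simpa [h0, h1] using this
  | (m + 4), v, h, i, j, hij => by
    obtain ⟨p, q, hpq, hp, hq⟩ := exists_two ({i, j} : Finset (Fin (m+4)))
      (by have := Finset.card_le_two (a := i) (b := j); omega)
    simp at hp hq
    obtain ⟨φ, hinj, hs, hd, -⟩ := Dg_drop_pair h p q hpq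
    obtain ⟨i, rfl⟩ := hs i (Ne.symm hp.1) (Ne.symm hq.1)
    obtain ⟨j, rfl⟩ := hs j (Ne.symm hp.2) (Ne.symm hq.2)
    have := Dg1_all (m+2) _ hd i j (by rintro rfl; exact hij rfl)
    simpa using this

theorem Dg2_disj {n : ℕ} {v : Sym2 (Fin n) → ℂ} (h : Dg 2 v) {p q i j : Fin n} (hpq : p ≠ q)
    (hv : v s(p,q) ≠ 0) (hij : i ≠ j) (h1 : i ≠ p) (h2 : i ≠ q) (h3 : j ≠ p) (h4 : j ≠ q) :
    v s(i,j) = 0 := by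
  match n, v, h, p, q, i, j, hpq, hv, hij, h1, h2, h3, h4 with
  | 0, v, h, p, q, i, j, hpq, hv, hij, h1, h2, h3, h4 => exact i.elim0
  | 1, v, h, p, q, i, j, hpq, hv, hij, h1, h2, h3, h4 => exact absurd (Subsingleton.elim i j) hij
  | (m+2), v, h, p, q, i, j, hpq, hv, hij, h1, h2, h3, h4 =>
    obtain ⟨φ, hinj, hs, -, hd⟩ := Dg_drop_pair h p q hpq
    obtain ⟨i, rfl⟩ := hs i h1 h2
    obtain ⟨j, rfl⟩ := hs j h3 h4
    have := Dg1_all m _ (hd hv) i j (by rintro rfl; exact hij rfl)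
    simpa using this

theorem fin3_aux : ∀ x : Fin 3, x ≠ 0 → x ≠ 1 → x = 2 := by decide

theorem fin4_aux : ∀ x : Fin 4, x ≠ 0 → x ≠ 1 → x = 2 ∨ x = 3 := by decide

theorem Dg2_tri : ∀ (n : ℕ) (v : Sym2 (Fin n) → ℂ), Dg 2 v → ∀ i j k, i ≠ j → i ≠ k → j ≠ k → 
    Tri (v s(i,j)) (v s(i,k)) (v s(j,k))
  | 0, _, _, i, _, _, _, _, _ => i.elim0
  | 1, _, _, i, j, _, hij, _, _ => absurd (Subsingleton.elim i j) hij
  | 2, v, h, i, j, k, hij, hik, hjk => by omega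
  | 3, v, h, i, j, k, hij, hik, hjk => by
    obtain ⟨σ, rfl, rfl⟩ := exists_perm_pair i j hij
    obtain ⟨x, rfl⟩ := σ.surjective k
    have hx : x = 2 := by
      have h1 : x ≠ 0 := by rintro rfl; exact hik rfl
      have h2 : x ≠ 1 := by rintro rfl; exact hjk rfl
      exact fin3_aux x h1 h2
    subst hx
    have := Dg2_three (Dg_perm h σ)
    simpa using this
  | 4, v, h, i, j, k, hij, hik, hjk => by
    obtain ⟨σ, rfl, rfl⟩ := exists_perm_pair i j hij
    obtain ⟨x, rfl⟩ := σ.surjective k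
    have hx : x = 2 ∨ x = 3 := by
      have h1 : x ≠ 0 := by rintro rfl; exact hik rfl
      have h2 : x ≠ 1 := by rintro rfl; exact hjk rfl
      exact fin4_aux x h1 h2
    rcases hx with rfl | rfl
    · have := Dg2_four (Dg_perm h σ)
      simpa using this
    · have := Dg2_four (Dg_perm h ((Equiv.swap 2 3).trans σ))
      have e0 : Equiv.swap (2 : Fin 4) 3 0 = 0 := by decide
      have e1 : Equiv.swap (2 : Fin 4) 3 1 = 1 := by decide
      simpa [e0, e1] using this
  | (m + 5), v, h, i, j, k, hij, hik, hjk => by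
    obtain ⟨p, q, hpq, hp, hq⟩ := exists_two ({i, j, k} : Finset (Fin (m+5)))
      (by have := Finset.card_le_three (a := i) (b := j) (c := k); omega)
    simp at hp hq
    obtain ⟨φ, hinj, hs, hd, -⟩ := Dg_drop_pair h p q hpq
    obtain ⟨i, rfl⟩ := hs i (Ne.symm hp.1) (Ne.symm hq.1)
    obtain ⟨j, rfl⟩ := hs j (Ne.symm hp.2.1) (Ne.symm hq.2.1)
    obtain ⟨k, rfl⟩ := hs k (Ne.symm hp.2.2) (Ne.symm hq.2.2)
    have := Dg2_tri (m+3) _ hd i j k (by rintro rfl; exact hij rfl) (by rintro rfl; exact hik rfl)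
       (by rintro rfl; exact hjk rfl)
    simpa using this

/-- star vectors centred at `i` -/
def StarAt {n : ℕ} (i : Fin n) (v : Sym2 (Fin n) → ℂ) : Prop :=
  ∃ β : ℂ, β ≠ 0 ∧ (∀ j, j ≠ i → v s(i,j) ^ 2 = β) ∧ ∀ j k, j ≠ i → k ≠ i → j ≠ k → v s(j,k) = 0

theorem Dg2_star_aux {n : ℕ} {v : Sym2 (Fin n) → ℂ} (h : Dg 2 v) {a b c : Fin n} (hab : a ≠ b)
    (hac : a ≠ c) (hbc : b ≠ c) (hv : v s(a,b) ≠ 0) (hc : v s(a,c) ≠ 0) :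
    StarAt a v := by
  have T := Dg2_tri n v h
  have key : ∀ j, j ≠ a → j ≠ b → v s(b,j) = 0 ∧ v s(a,j)^2 = v s(a,b)^2 := by
    have kc : v s(b,c) = 0 := by
      have := (T a b c hab hac hbc).1
      simpa [hv, hc] using this
    intro j hja hjb
    have k0 : v s(b,j) = 0 := by
      by_cases hjc : j = c
      · rw [hjc]; exact kc
      · exact Dg2_disj h hac hc hjb.symm hab.symm hbc hja hjc
    exact ⟨k0, ((T a b j hab hja.symm hjb.symm).2 k0).symm⟩
  refine ⟨v s(a,b)^2, pow_ne_zero 2 hv, ?_, ?_⟩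
  · intro j hj
    by_cases hjb : j = b
    · rw [hjb]
    · exact (key j hj hjb).2
  · intro j k hj hk hjk
    by_cases hjb : j = b
    · rw [hjb]; exact (key k hk (by rintro rfl; exact hjk hjb)).1
    by_cases hkb : k = b
    · rw [hkb, Sym2.eq_swap]; exact (key j hj hjb).1
    exact Dg2_disj h hab hv hjk hj hjb hk hkb

theorem Dg2_star {n : ℕ} (hn : 3 ≤ n) {v : Sym2 (Fin n) → ℂ} (h : Dg 2 v) {a b : Fin n}
    (hab : a ≠ b) (hv : v s(a,b) ≠ 0) : ∃ i, StarAt i v := by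
  have : ∃ c, c ∉ ({a, b} : Finset (Fin n)) := by
    by_contra hcon
    push Not at hcon
    have h1 : ({a, b} : Finset (Fin n)) = Finset.univ := Finset.eq_univ_iff_forall.2 hcon
    have h2 := Finset.card_le_two (a := a) (b := b)
    rw [h1, Finset.card_univ, Fintype.card_fin] at h2
    omega
  obtain ⟨c, hc⟩ := this
  simp at hc
  by_cases h1 : v s(a,c) = 0
  · refine ⟨b, Dg2_star_aux h hab.symm (Ne.symm hc.2) (Ne.symm hc.1) (by rwa [Sym2.eq_swap]) (c := c) ?_⟩
    intro h2
    have := (Dg2_tri n v h b c a (Ne.symm hc.2) hab.symm hc.1).2 (by rwa [Sym2.eq_swap])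
    rw [h2, Sym2.eq_swap] at this
    simp at this
    exact hv (by simpa using this.symm)
  · exact ⟨a, Dg2_star_aux h hab (Ne.symm hc.1) (Ne.symm hc.2) hv h1⟩


open Polynomial in
theorem star_det {m : ℕ} (M : Matrix (Fin (m+1)) (Fin (m+1)) ℂ[X]) (y : Fin (m+1) → Fin (m+1) → ℂ)
    (a : Fin (m+1) → ℂ[X]) (hM : ∀ i j, M i j = C (y i j) - a j - a i)
    (h2 : ∀ i, (a i).natDegree ≤ 2) (h1 : ∀ i j, (a i - a j).natDegree ≤ 1) :
    M.det.natDegree ≤ 2 := by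
  let B : Matrix (Fin (m+1)) (Fin (m+1)) ℂ[X] :=
    Matrix.of (Fin.cons (fun j => M 0 j)
      fun i => fun j => M i.succ j - M 0 j)
  let D : Matrix (Fin (m+1)) (Fin (m+1)) ℂ[X] :=
    Matrix.of (fun i => Fin.cons (B i 0) fun j => B i j.succ - B i 0)
  have e1 : M.det = B.det := by
    refine Matrix.det_eq_of_forall_row_eq_smul_add_const (Fin.cons 0 fun _ => 1) 0 (by simp) ?_
    intro i j
    refine Fin.cases ?_ (fun i => ?_) i
    · simp [B]
    · simp [B]
  have e2 : B.det = D.det := by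
    rw [← Matrix.det_transpose, ← Matrix.det_transpose D]
    refine Matrix.det_eq_of_forall_row_eq_smul_add_const (Fin.cons 0 fun _ => 1) 0 (by simp) ?_
    intro i j
    refine Fin.cases ?_ (fun i => ?_) i
    · simp [D]
    · simp [D]
  rw [e1, e2]
  have := natDegree_det_le_weights D (Fin.cons 1 fun _ => 0) (Fin.cons 1 fun _ => 0) ?_
  · simpa [Fin.sum_univ_succ] using this
  intro i j
  refine Fin.cases ?_ (fun i => ?_) i <;> refine Fin.cases ?_ (fun j => ?_) j
  · simp only [D, B, Matrix.of_apply, Fin.cons_zero, hM]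
    refine (natDegree_sub_le_of_le (natDegree_sub_le_of_le (m := 2) (n := 2) (by simp) (h2 _)) (h2 _)).trans (by simp)
  · simp only [D, B, Matrix.of_apply, Fin.cons_zero, Fin.cons_succ, hM]
    have : C (y 0 j.succ) - a j.succ - a 0 - (C (y 0 0) - a 0 - a 0)
      = (C (y 0 j.succ - y 0 0)) - (a j.succ - a 0) := by rw [C_sub]; ring
    rw [this]
    exact (natDegree_sub_le_of_le (m := 1) (n := 1) (by rw [natDegree_C]; simp) (h1 _ _)).trans (by simp)
  · simp only [D, B, Matrix.of_apply, Fin.cons_zero, Fin.cons_succ, hM]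
    have : C (y i.succ 0) - a 0 - a i.succ - (C (y 0 0) - a 0 - a 0)
      = (C (y i.succ 0 - y 0 0)) - (a i.succ - a 0) := by rw [C_sub]; ring
    rw [this]
    exact (natDegree_sub_le_of_le (m := 1) (n := 1) (by rw [natDegree_C]; simp) (h1 _ _)).trans (by simp)
  · simp only [D, B, Matrix.of_apply, Fin.cons_succ, hM]
    have : C (y i.succ j.succ) - a j.succ - a i.succ - (C (y 0 j.succ) - a j.succ - a 0) -
      (C (y i.succ 0) - a 0 - a i.succ - (C (y 0 0) - a 0 - a 0))
      = (C (y i.succ j.succ - y 0 j.succ - y i.succ 0 + y 0 0)) := by simp only [C_sub, C_add]; ring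
    rw [this, natDegree_C]

open Polynomial in
theorem star_Dg_zero {m : ℕ} {v : Sym2 (Fin (m+1)) → ℂ} (h : StarAt 0 v) : Dg 2 v := by
  intro x
  rw [FF_eq_det]
  match m, v, h, x with
  | 0, v, h, x => simp
  | m+1, v, h, x =>
    obtain ⟨β, -, h1, h2⟩ := h
    have ea : ∀ j : Fin (m+1), Ym (fun e => C (x e) + X * C (v e)) 0 j.succ = 
        C (x s(0,j.succ) ^ 2) + C (2 * x s(0,j.succ) * v s(0,j.succ)) * X + C β * X^2 := by
      intro j
      rw [← h1 j.succ (Fin.succ_ne_zero j)]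
      simp [Ym, (Fin.succ_ne_zero j).symm]
      simp only [map_ofNat]
      ring
    refine star_det _ (fun i j => if i = j then 0 else x s(i.succ, j.succ)^2) 
      (fun j => Ym (fun e => C (x e) + X * C (v e)) 0 j.succ) ?_ ?_ ?_
    · intro i j
      have : Ym (fun e => C (x e) + X * C (v e)) i.succ 0 = 
        Ym (fun e => C (x e) + X * C (v e)) 0 i.succ := by
        simp [Ym, Sym2.eq_swap (a := (0 : Fin (m+2))), eq_comm (a := (0 : Fin (m+2)))]
      simp only [Km, Matrix.of_apply, this]
      congr 2
      by_cases hij : i = j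
      · simp [hij, Ym]
      · have := h2 i.succ j.succ (Fin.succ_ne_zero i) (Fin.succ_ne_zero j) (by simpa using hij)
        simp [hij, Ym, this]
    · intro i
      rw [ea]
      compute_degree
    · intro i j
      rw [ea, ea]
      have : ∀ a b c a' b' : ℂ[X], (a + b * X + c * X^2) - (a' + b' * X + c * X^2) = (a - a') + (b - b') * X := by
        intros; ring
      rw [this, ← C_sub, ← C_sub]
      compute_degree

theorem star_perm {n : ℕ} {v : Sym2 (Fin n) → ℂ} {i : Fin n} (h : StarAt i v) (σ : Equiv.Perm (Fin n)) :
    StarAt (σ.symm i) (fun e => v (e.map σ)) := by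
  obtain ⟨β, h0, h1, h2⟩ := h
  refine ⟨β, h0, ?_, ?_⟩
  · intro j hj
    simp only [Sym2.map_mk, Equiv.apply_symm_apply]
    exact h1 _ (by rintro rfl; simp at hj)
  · intro j k hj hk hjk
    simp only [Sym2.map_mk]
    exact h2 _ _ (by rintro rfl; simp at hj) (by rintro rfl; simp at hk) (by simpa using hjk)

theorem star_Dg {n : ℕ} {v : Sym2 (Fin n) → ℂ} {i : Fin n} (h : StarAt i v) : Dg 2 v := by
  match n, v, i, h with
  | 0, _, i, _ => exact i.elim0
  | m+1, v, i, h =>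
    have h1 := star_perm h (Equiv.swap 0 i)
    simp only [Equiv.symm_swap, Equiv.swap_apply_right] at h1
    have h2 := Dg_perm (star_Dg_zero h1) (Equiv.swap 0 i)
    have e : ∀ e : Sym2 (Fin (m+1)), Sym2.map (Equiv.swap 0 i) (Sym2.map (Equiv.swap 0 i) e) = e := by
      intro e
      induction e with | h a b => simp
    simpa [e] using h2


theorem sym_factor {d : ℕ} (G : Matrix (Fin (d+1)) (Fin (d+1)) ℂ) (hs : G.IsSymm)
    (hdet : G.det = 0) : ∃ p : Fin (d+1) → Fin d → ℂ, ∀ i j, G i j = ∑ k, p i k * p j k := by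
  have : Invertible (2 : ℂ) := invertibleOfNonzero two_ne_zero
  obtain ⟨v0, hv0⟩ := LinearMap.BilinForm.exists_orthogonal_basis (B := Matrix.toBilin' G)
    ⟨fun x y => (Matrix.isSymm_toBilin'_iff_isSymm.2 hs).eq x y⟩
  have hf : Module.finrank ℂ (Fin (d+1) → ℂ) = d + 1 := by simp
  let v := v0.reindex (finCongr hf)
  have hv : ∀ i j, i ≠ j → Matrix.toBilin' G (v i) (v j) = 0 := by
    intro i j hij
    simp only [v, Module.Basis.reindex_apply]
    exact hv0 (by simpa using hij)
  have expand : ∀ a b, Matrix.toBilin' G a b = ∑ k, v.repr a k * v.repr b k * Matrix.toBilin' G (v k) (v k) := by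
    intro a b
    conv_lhs => rw [← v.sum_repr a, ← v.sum_repr b]
    simp only [map_sum, LinearMap.sum_apply, map_smul, LinearMap.smul_apply, smul_eq_mul]
    refine Finset.sum_congr rfl fun k _ => ?_
    rw [Finset.sum_eq_single k]
    · ring
    · intro j _ hj
      rw [hv j k hj]; simp
    · simp
  obtain ⟨z, hz, hGz⟩ := Matrix.exists_mulVec_eq_zero_iff.2 hdet
  have : ∃ k0, v.repr z k0 ≠ 0 := by
    by_contra hcon
    push Not at hcon
    apply hz
    apply v.repr.injective
    ext k
    simp [hcon k]
  obtain ⟨k0, hk0⟩ := this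
  have hg : Matrix.toBilin' G (v k0) (v k0) = 0 := by
    have h1 := expand (v k0) z
    rw [Matrix.toBilin'_apply', hGz, dotProduct_zero, Finset.sum_eq_single k0] at h1
    · simpa [hk0] using h1.symm
    · intro b _ hb
      simp [Finsupp.single_apply, hb.symm]
    · simp
  have hsq : ∀ k, ∃ s : ℂ, Matrix.toBilin' G (v k) (v k) = s * s := fun k =>
    IsAlgClosed.exists_eq_mul_self _
  choose s hs using hsq
  refine ⟨fun i k => v.repr (Pi.single i 1) (k0.succAbove k) * s (k0.succAbove k), fun i j => ?_⟩
  have := expand (Pi.single i 1) (Pi.single j 1)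
  rw [Matrix.toBilin'_single, Fin.sum_univ_succAbove _ k0, hg] at this
  rw [this]
  simp only [mul_zero, zero_add]
  refine Finset.sum_congr rfl fun k _ => ?_
  rw [hs]; ring

/-- extension by zero -/
noncomputable def ext0 {R : Type*} [Zero R] {n : ℕ} (x : Edge n → R) : Sym2 (Fin n) → R := fun e =>
  open Classical in if h : ¬ e.IsDiag then x ⟨e, h⟩ else 0

theorem ext0_edge {R : Type*} [Zero R] {n : ℕ} (x : Edge n → R) (e : Edge n) : ext0 x e.1 = x e := by
  simp [ext0, e.2]

theorem Km_symm {R : Type*} [CommRing R] {m : ℕ} (w : Sym2 (Fin (m+1)) → R) : (Km w).IsSymm := by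
  ext i j
  simp only [Km, Ym, Matrix.transpose_apply, Matrix.of_apply, Sym2.eq_swap (a := j.succ) (b := i.succ),
    eq_comm (a := j.succ) (b := i.succ), eq_comm (a := (0 : Fin (m+1))),
    Sym2.eq_swap (a := (0 : Fin (m+1)))]
  ring

theorem L_iff {d : ℕ} (x : Edge (d+2) → ℂ) : x ∈ Lvar d (d+2) ↔ FF (ext0 x) = 0 := by
  have hY : ∀ p : Fin (d+2) → Fin d → ℂ, (∀ e : Edge (d+2), x e ^ 2 = cSqLen p e.1) ↔ 
      ∀ i j, Ym (ext0 x) i j = ∑ k, (p i k - p j k)^2 := by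
    intro p
    constructor
    · intro h i j
      by_cases hij : i = j
      · simp [Ym, hij]
      · have := h ⟨s(i,j), by simpa using hij⟩
        simp only [Ym, Matrix.of_apply, hij, if_false]
        rw [← ext0_edge x] at this
        simpa [cSqLen] using this
    · rintro h ⟨e, he⟩
      induction e with | h i j => 
      have := h i j
      have hij : i ≠ j := by simpa using he
      simp only [Ym, Matrix.of_apply, hij, if_false] at this
      rw [← ext0_edge x]
      simpa [cSqLen] using this
  have hL : x ∈ Lvar d (d+2) ↔ ∃ p : Fin (d+2) → Fin d → ℂ, ∀ i j, Ym (ext0 x) i j = ∑ k, (p i k - p j k)^2 := by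
    simp only [← hY]
    rfl
  rw [hL, FF_eq_det]
  constructor
  · rintro ⟨p, hp⟩
    let P : Matrix (Fin (d+1)) (Fin d) ℂ := Matrix.of fun i k => p i.succ k - p 0 k
    have hK : Km (ext0 x) = P * ((-2 : ℂ) • P.transpose) := by
      ext i j
      simp only [Km, Matrix.of_apply, hp, Matrix.mul_apply, P, Matrix.smul_apply, Matrix.transpose_apply,
        ← Finset.sum_sub_distrib, smul_eq_mul]
      refine Finset.sum_congr rfl fun k _ => ?_
      ring
    rw [hK, ← Matrix.exists_mulVec_eq_zero_iff]
    have hker : LinearMap.ker (Matrix.mulVecLin ((-2 : ℂ) • P.transpose)) ≠ ⊥ := by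
      apply LinearMap.ker_ne_bot_of_finrank_lt
      simp
    obtain ⟨z, hz, hz0⟩ := Submodule.exists_mem_ne_zero_of_ne_bot hker
    refine ⟨z, hz0, ?_⟩
    rw [← Matrix.mulVec_mulVec]
    have : ((-2 : ℂ) • P.transpose).mulVec z = 0 := by simpa only [LinearMap.mem_ker, Matrix.mulVecLin_apply] using hz
    rw [this]; simp
  · intro hdet
    obtain ⟨p, hp⟩ := sym_factor ((-1/2 : ℂ) • Km (ext0 x)) 
      ((Km_symm _).smul _) (by rw [Matrix.det_smul, hdet, mul_zero])
    have hK : ∀ i j, Km (ext0 x) i j = ∑ k, (-2) * (p i k * p j k) := by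
      intro i j
      have := hp i j
      rw [← Finset.mul_sum, ← this]
      simp only [Matrix.smul_apply, smul_eq_mul]
      ring
    have hsym : ∀ i j, Ym (ext0 x) i j = Ym (ext0 x) j i := by
      intro i j
      simp only [Ym, Matrix.of_apply, Sym2.eq_swap (a := j) (b := i),
    eq_comm (a := j) (b := i)]
    have hdiag : ∀ i, Ym (ext0 x) i i = 0 := by
      intro i; simp [Ym]
    have h0 : ∀ j : Fin (d+1), Ym (ext0 x) 0 j.succ = ∑ k, p j k ^2 := by
      intro j
      have := hK j j
      rw [← Finset.mul_sum] at this
      simp only [Km, Matrix.of_apply, hdiag, hsym j.succ 0] at this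
      simp only [pow_two]
      linear_combination (-1/2) * this
    refine ⟨Fin.cons 0 p, fun i j => ?_⟩
    refine Fin.cases ?_ (fun i => ?_) i <;> refine Fin.cases ?_ (fun j => ?_) j
    · simp [hdiag]
    · simp [h0]
    · simp [h0, hsym _ 0]
    · have := hK i j
      simp only [Km, Matrix.of_apply, h0, hsym i.succ 0] at this
      simp only [Fin.cons_succ]
      have e : Ym (ext0 x) i.succ j.succ = ∑ k, (-2) * (p i k * p j k) + ∑ k, p j k ^2 + ∑ k, p i k ^ 2 := by
        rw [← this]; ring
      rw [e, ← Finset.sum_add_distrib, ← Finset.sum_add_distrib]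
      refine Finset.sum_congr rfl fun k _ => ?_
      ring


open Polynomial in
/-- entries of the special matrix -/
noncomputable def gent (a b : ℕ) : ℂ[X] :=
  if a = b then (if a = 1 then -8 else -2) else
    if (a = 0 ∧ b = 1) ∨ (a = 1 ∧ b = 0) then X ^ 2 - 5 else 0

open Polynomial in
theorem det_gent (m : ℕ) : (Matrix.of fun i j : Fin (m+2) => gent i.val j.val).det =
    (-2) ^ m * (-(X^4 - 10 * X^2 + 9)) := by
  induction m with
  | zero =>
    rw [Matrix.det_fin_two]
    simp [gent]
    ring
  | succ m ih =>
    rw [Matrix.det_succ_row _ (Fin.last _), Finset.sum_eq_single (Fin.last _)]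
    · have : (Matrix.of fun i j : Fin (m+1+2) => gent i.val j.val).submatrix (Fin.last (m+2)).succAbove
        (Fin.last (m+2)).succAbove = (Matrix.of fun i j : Fin (m+2) => gent i.val j.val) := by
        ext1 i j
        simp
      rw [this, ih]
      have e : gent (m+2) (m+2) = -2 := by simp [gent]
      simp [e, ← two_mul, pow_mul]
      ring
    · intro j _ hj
      have h1 : j.val < m + 2 := Fin.val_lt_last hj
      have e : gent (m+2) j.val = 0 := by
        simp only [gent]
        rw [if_neg (by omega), if_neg (by omega)]
      simp [e]
    · simp

/-- special radii -/
def rad {n : ℕ} (i : Fin n) : ℂ := if i.val = 0 then 0 else if i.val = 2 then 4 else 1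

/-- special squared lengths -/
def radsum {n : ℕ} : Sym2 (Fin n) → ℂ := Sym2.lift ⟨fun i j => rad i + rad j, fun _ _ => add_comm _ _⟩

open Polynomial in
theorem spec12 (m : ℕ) : ∃ x0 : Sym2 (Fin (m+3)) → ℂ,
    FF (fun e => if e = s(1,2) then X else C (x0 e)) = (-2) ^ m * (-(X^4 - 10 * X^2 + 9)) := by
  have hsq : ∀ e : Sym2 (Fin (m+3)), ∃ s : ℂ, s ^ 2 = radsum e := fun e =>
    ⟨_, (IsAlgClosed.exists_pow_nat_eq _ two_pos).choose_spec⟩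
  choose x0 hx0 using hsq
  refine ⟨x0, ?_⟩
  rw [FF_eq_det, ← det_gent]
  congr 1
  have hY : ∀ i j, Ym (fun e => if e = s(1,2) then X else C (x0 e)) i j =
      if i = j then 0 else if s(i,j) = s((1 : Fin (m+3)),2) then X^2 else C (rad i) + C (rad j) := by
    intro i j
    simp only [Ym, Matrix.of_apply]
    split_ifs
    · rfl
    · rfl
    · rw [← C_pow, hx0, ← C_add]; rfl
  have h1 : ((1 : Fin (m+3)) : ℕ) = 1 := rfl
  have h2 : ((2 : Fin (m+3)) : ℕ) = 2 := rfl
  ext1 i j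
  simp only [Km, Matrix.of_apply, hY]
  have n1 : s(0, j.succ) ≠ s((1 : Fin (m+3)),2) := by
    intro h
    simp only [Sym2.eq_iff, Fin.ext_iff, h1, h2, Fin.val_succ, Fin.val_zero] at h
    omega
  have n2 : s(i.succ, 0) ≠ s((1 : Fin (m+3)),2) := by
    intro h
    simp only [Sym2.eq_iff, Fin.ext_iff, h1, h2, Fin.val_succ, Fin.val_zero] at h
    omega
  have n3 : s(i.succ, j.succ) = s((1 : Fin (m+3)),2) ↔ (i.val = 0 ∧ j.val = 1) ∨ (i.val = 1 ∧ j.val = 0) := by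
    simp only [Sym2.eq_iff, Fin.ext_iff, h1, h2, Fin.val_succ]
    omega
  have n4 : i.succ = j.succ ↔ i.val = j.val := by simp [Fin.ext_iff]
  simp only [n1, n2, n3, n4, if_false, Fin.succ_ne_zero, (Fin.succ_ne_zero _).symm, gent]
  have r0 : rad (0 : Fin (m+3)) = 0 := by simp [rad]
  have rs : ∀ i : Fin (m+2), rad i.succ = if i.val = 1 then 4 else 1 := by
    intro i
    simp [rad]
  rw [r0, rs, rs, C_0]
  have c4 : (C 4 : ℂ[X]) = 4 := rfl
  by_cases hij : i.val = j.val
  · rw [if_pos hij, if_pos hij, hij]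
    split_ifs
    · rw [c4]; ring
    · rw [C_1]; ring
  · rw [if_neg hij, if_neg hij]
    by_cases hs : (i.val = 0 ∧ j.val = 1) ∨ (i.val = 1 ∧ j.val = 0)
    · rw [if_pos hs, if_pos hs]
      rcases hs with ⟨hi, hj⟩ | ⟨hi, hj⟩
      · rw [hi, hj]; simp [c4]; ring
      · rw [hi, hj]; simp [c4]; ring
    · rw [if_neg hs, if_neg hs]; ring

open Polynomial in
theorem spec_any {m : ℕ} (i j : Fin (m+3)) (hij : i ≠ j) : ∃ x0 : Sym2 (Fin (m+3)) → ℂ,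
    FF (fun e => if e = s(i,j) then X else C (x0 e)) = (-2) ^ m * (-(X^4 - 10 * X^2 + 9)) := by
  obtain ⟨x0, h⟩ := spec12 m
  have hne : (1 : Fin (m+3)) ≠ 2 := by
    intro h; have := congrArg Fin.val h; 
    change 1 = 2 at this; omega
  obtain ⟨σ, h0, h1⟩ := exists_perm_pair i j hij
  obtain ⟨τ, g0, g1⟩ := exists_perm_pair 1 2 hne
  let ρ := σ.symm.trans τ
  have r1 : ρ i = 1 := by simp [ρ, ← h0, g0]
  have r2 : ρ j = 2 := by simp [ρ, ← h1, g1]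
  refine ⟨fun e => x0 (e.map ρ), ?_⟩
  rw [← h, ← FF_perm ρ (fun e => if e = s(1,2) then X else C (x0 e))]
  congr 1
  ext1 e
  have : e = s(i,j) ↔ e.map ρ = s(1,2) := by
    rw [← r1, ← r2, ← Sym2.map_mk]
    exact (Sym2.map.injective ρ.injective).eq_iff.symm
  simp only [this]

open Polynomial in
theorem sep_special : Squarefree (X^4 - 10 * X^2 + 9 : ℂ[X]) := by
  apply Separable.squarefree
  rw [separable_def']
  have d : derivative (X^4 - 10 * X^2 + 9 : ℂ[X]) = 4 * X^3 - 20 * X := by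
    have : (10 : ℂ[X]) = C 10 := rfl
    have h9 : (9 : ℂ[X]) = C 9 := rfl
    rw [this, h9]
    simp only [derivative_add, derivative_sub, derivative_C_mul, derivative_X_pow, derivative_C]
    simp only [map_ofNat, Nat.cast_ofNat, ← this]
    ring
  rw [d]
  have e9 : C (1/9 : ℂ) * 9 = 1 := by
    have h9 : (9 : ℂ[X]) = C 9 := rfl
    rw [h9, ← C_mul]; norm_num
  have e16 : C (1/16 : ℂ) * 16 = 1 := by
    have h9 : (16 : ℂ[X]) = C 16 := rfl
    rw [h9, ← C_mul]; norm_num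
  refine ⟨C (1/9) * (1 - 5 * C (1/16) * X^2), C (1/9) * (- 4 * C (1/16) * X * (1 - 5 * C (1/16) * X^2)
    - 100 * C (1/16) * C (1/16) * X), ?_⟩
  generalize (C (1/9) : ℂ[X]) = u at *
  generalize (C (1/16) : ℂ[X]) = w at *
  grind


/-- the defining polynomial -/
noncomputable def fpoly (n : ℕ) : MvPolynomial (Edge n) ℂ := FF (ext0 (MvPolynomial.X : Edge n → _))

theorem map_fpoly {S : Type*} [CommRing S] {n : ℕ} (φ : MvPolynomial (Edge n) ℂ →+* S)
    (w : Sym2 (Fin n) → S) (h : ∀ e : Edge n, φ (MvPolynomial.X e) = w e.1) : φ (fpoly n) = FF w := by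
  rw [fpoly, ← FF_map]
  apply FF_congr
  intro e he
  rw [← h ⟨e, he⟩]
  simp [ext0, he]

theorem eval_fpoly {n : ℕ} (x : Edge n → ℂ) : MvPolynomial.eval x (fpoly n) = FF (ext0 x) :=
  map_fpoly _ _ fun e => by rw [ext0_edge]; simp

open Polynomial in
theorem natDegree_FF_le {R : Type*} [CommRing R] {n : ℕ} (i j : Fin n) (x : Sym2 (Fin n) → R) :
    (FF (fun e => if e = s(i,j) then X else C (x e))).natDegree ≤ 4 := by
  have key : ∀ c : R, (Ym (fun e => if e = s(i,j) then X else C (x e)) + Jm n (C c)).det.natDegree ≤ 4 := by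
    intro c
    refine (natDegree_det_le_weights _ (fun k => (if k = i then 2 else 0) + (if k = j then 2 else 0)) 0 ?_).trans ?_
    · intro a b
      simp only [Ym, Jm, Matrix.add_apply, Matrix.of_apply]
      by_cases hab : a = b
      · simp [hab]
      · rw [if_neg hab]
        by_cases hs : s(a,b) = s(i,j)
        · rw [if_pos hs]
          have : a = i ∨ a = j := by
            rw [Sym2.eq_iff] at hs; tauto
          have h2 : 2 ≤ (if a = i then 2 else 0) + (if a = j then 2 else 0) := by
            rcases this with h | h <;> simp [h]
          refine le_trans ?_ (le_trans h2 (Nat.le_add_right _ _))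
          compute_degree
        · rw [if_neg hs, ← C_pow, ← C_add, natDegree_C]; simp
    · simp [Finset.sum_add_distrib]
  unfold FF
  have h1 := key 1
  have h0 := key 0
  rw [C_1] at h1
  rw [C_0] at h0
  exact natDegree_sub_le_of_le h1 h0 |>.trans (by simp)

section sqf
open Polynomial

/-- view as a univariate polynomial in one variable -/
noncomputable def Phi {n : ℕ} (e : Edge n) : MvPolynomial (Edge n) ℂ →+* (MvPolynomial (Edge n) ℂ)[X] :=
  MvPolynomial.eval₂Hom (C.comp MvPolynomial.C) (fun e' => if e' = e then X else C (MvPolynomial.X e'))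

theorem Phi_eval {n : ℕ} (e : Edge n) (h : MvPolynomial (Edge n) ℂ) (x : Edge n → ℂ) (t : ℂ) :
    MvPolynomial.eval (Function.update x e t) h =
      Polynomial.eval t (Polynomial.map (MvPolynomial.eval x) (Phi e h)) := by
  have : (MvPolynomial.eval (Function.update x e t) : MvPolynomial (Edge n) ℂ →+* ℂ) =
    (Polynomial.evalRingHom t).comp ((Polynomial.mapRingHom (MvPolynomial.eval x)).comp (Phi e)) := by
    apply MvPolynomial.ringHom_ext
    · intro r; simp [Phi]
    · intro e'
      by_cases he : e' = e
      · subst he; simp [Phi]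
      · simp [Phi, he]
  rw [this]; rfl

theorem indep {m : ℕ} {h : MvPolynomial (Edge (m+3)) ℂ} (hh : h * h ∣ fpoly (m+3)) (e : Edge (m+3)) :
    (Phi e h).natDegree = 0 := by
  obtain ⟨g, hg⟩ := hh
  obtain ⟨⟨e, he⟩, rfl⟩ : ∃ e', e' = e := ⟨e, rfl⟩
  induction e with | h i j =>
  have hij : i ≠ j := by simpa using he
  obtain ⟨x0, hx0⟩ := spec_any i j hij
  set E : Edge (m+3) := ⟨s(i,j), he⟩ with hE
  let S : (MvPolynomial (Edge (m+3)) ℂ)[X] →+* ℂ[X] := Polynomial.mapRingHom (MvPolynomial.eval (fun e => x0 e.1))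
  have hPf : Phi E (fpoly (m+3)) = FF (fun e => if e = s(i,j) then X else C (ext0 (MvPolynomial.X : Edge (m+3) → MvPolynomial (Edge (m+3)) ℂ) e)) := by
    apply map_fpoly
    intro e'
    rw [ext0_edge]
    have : e' = E ↔ e'.1 = s(i,j) := by rw [hE, Subtype.ext_iff]
    simp [Phi, this]
  have hSf : S (Phi E (fpoly (m+3))) = (-2) ^ m * (-(X^4 - 10 * X^2 + 9)) := by
    rw [← hx0]
    refine map_fpoly (S.comp (Phi E)) _ ?_
    intro e'
    have : e' = E ↔ e'.1 = s(i,j) := by rw [hE, Subtype.ext_iff]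
    by_cases h : e' = E
    · have h2 := this.1 h
      rw [if_pos h2]
      simp [Phi, h, S]
    · have h2 := (not_congr this).1 h
      simp [Phi, h2, h, S]
  have hc : ((-2) ^ m * (-(X^4 - 10 * X^2 + 9)) : ℂ[X]) = C (-(-2)^m) * (X^4 - 10 * X^2 + 9) := by
    simp only [map_neg, map_pow, map_ofNat]; ring
  have hu : IsUnit (C (-(-2)^m : ℂ)) := isUnit_C.2 (by simp)
  have hdeg4 : (X^4 - 10 * X^2 + 9 : ℂ[X]).natDegree = 4 := by
    have : (10 : ℂ[X]) = C 10 := rfl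
    have h9 : (9 : ℂ[X]) = C 9 := rfl
    rw [this, h9]
    compute_degree!
  have hnd : (S (Phi E (fpoly (m+3)))).natDegree = 4 := by
    rw [hSf, hc, natDegree_C_mul (by simp), hdeg4]
  have hne : S (Phi E (fpoly (m+3))) ≠ 0 := by
    intro h; rw [h] at hnd; simp at hnd
  have hle : (Phi E (fpoly (m+3))).natDegree ≤ 4 := by
    rw [hPf]; exact natDegree_FF_le _ _ _
  rw [hg] at hne hnd hle hSf
  simp only [map_mul] at hne hnd hle hSf
  have n1 : S (Phi E h) ≠ 0 := by intro h; simp [h] at hne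
  have n2 : S (Phi E g) ≠ 0 := by intro h; simp [h] at hne
  have n3 : Phi E h ≠ 0 := by intro h; simp [h] at hne
  have n4 : Phi E g ≠ 0 := by intro h; simp [h] at hne
  rw [natDegree_mul (mul_ne_zero n1 n1) n2, natDegree_mul n1 n1] at hnd
  rw [natDegree_mul (mul_ne_zero n3 n3) n4, natDegree_mul n3 n3] at hle
  have l1 : (S (Phi E h)).natDegree ≤ (Phi E h).natDegree := natDegree_map_le
  have l2 : (S (Phi E g)).natDegree ≤ (Phi E g).natDegree := natDegree_map_le
  have : IsUnit (S (Phi E h)) := by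
    apply sep_special
    rw [hc] at hSf
    rw [← hu.dvd_mul_left, ← hSf]
    exact Dvd.intro _ rfl
  have := natDegree_eq_zero_of_isUnit this
  omega

theorem fpoly_ne_zero (m : ℕ) : fpoly (m+3) ≠ 0 := by
  intro h
  have hij : (0 : Fin (m+3)) ≠ 1 := by
    intro h; have := congrArg Fin.val h; change 0 = 1 at this; omega
  have h1 := indep (h := MvPolynomial.X ⟨s(0,1), by simpa using hij⟩) (by rw [h]; simp) ⟨s(0,1), by simpa using hij⟩
  simp [Phi] at h1

theorem fpoly_squarefree (m : ℕ) : Squarefree (fpoly (m+3)) := by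
  intro h hh
  have key : ∀ (e : Edge (m+3)) x t, MvPolynomial.eval (Function.update x e t) h = MvPolynomial.eval x h := by
    intro e x t
    have e2 := Phi_eval e h x t
    have e3 := Phi_eval e h x (x e)
    rw [Function.update_eq_self] at e3
    rw [e2, e3, eq_C_of_natDegree_eq_zero (indep hh e)]
    simp
  have key2 : ∀ (s : Finset (Edge (m+3))) x y, MvPolynomial.eval (s.piecewise x y) h = MvPolynomial.eval y h := by
    intro s x y
    induction s using Finset.induction_on with
    | empty => simp
    | insert a s ha ih => rw [Finset.piecewise_insert, key, ih]
  have hC : h = MvPolynomial.C (MvPolynomial.eval 0 h) := by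
    apply MvPolynomial.funext
    intro x
    rw [MvPolynomial.eval_C, ← key2 Finset.univ x 0]
    simp
  rw [hC]
  apply IsUnit.map
  rw [isUnit_iff_ne_zero]
  intro h0
  rw [h0, map_zero] at hC
  rw [hC] at hh
  simp at hh
  exact fpoly_ne_zero m hh

end sqf


theorem dvd_of_vanish {σ : Type*} [Finite σ] {f p : MvPolynomial σ ℂ} (hf : Squarefree f) (h0 : f ≠ 0)
    (h : ∀ x, MvPolynomial.eval x f = 0 → MvPolynomial.eval x p = 0) : f ∣ p := by
  have h1 : p ∈ MvPolynomial.vanishingIdeal ℂ (MvPolynomial.zeroLocus ℂ (Ideal.span {f})) := by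
    intro x hx
    have := hx f (Ideal.mem_span_singleton_self f)
    rw [MvPolynomial.aeval_eq_eval] at this ⊢
    exact h x this
  rw [MvPolynomial.vanishingIdeal_zeroLocus_eq_radical] at h1
  obtain ⟨n, hn⟩ := h1
  exact (isRadical_iff_squarefree_of_ne_zero h0).2 hf n p (Ideal.mem_span_singleton.1 hn)

/-- pull back of polynomials along a matrix -/
noncomputable def pull {n : ℕ} (A : Matrix (Edge n) (Edge n) ℂ) :
    MvPolynomial (Edge n) ℂ →+* MvPolynomial (Edge n) ℂ :=
  MvPolynomial.eval₂Hom MvPolynomial.C (fun e => ∑ f, MvPolynomial.C (A e f) * MvPolynomial.X f)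

theorem eval_pull {n : ℕ} (A : Matrix (Edge n) (Edge n) ℂ) (x : Edge n → ℂ) (p : MvPolynomial (Edge n) ℂ) :
    MvPolynomial.eval x (pull A p) = MvPolynomial.eval (A.mulVec x) p := by
  have : (MvPolynomial.eval (A.mulVec x) : MvPolynomial (Edge n) ℂ →+* ℂ) =
    (MvPolynomial.eval x).comp (pull A) := by
    apply MvPolynomial.ringHom_ext
    · intro r; simp [pull]
    · intro e; simp [pull, Matrix.mulVec, dotProduct]
  rw [this]; rfl

theorem FF_scale {m : ℕ} (A B : Matrix (Edge (m+3)) (Edge (m+3)) ℂ) (hBA : B * A = 1)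
    (hA : ∀ x, FF (ext0 x) = 0 → FF (ext0 (A.mulVec x)) = 0)
    (hB : ∀ x, FF (ext0 x) = 0 → FF (ext0 (B.mulVec x)) = 0) :
    ∃ c : ℂ, ∀ x, FF (ext0 (A.mulVec x)) = c * FF (ext0 x) := by
  have h0 := fpoly_ne_zero m
  have hs := fpoly_squarefree m
  obtain ⟨h, hh⟩ : fpoly (m+3) ∣ pull A (fpoly (m+3)) := by
    apply dvd_of_vanish hs h0
    intro x hx
    rw [eval_pull, eval_fpoly]
    rw [eval_fpoly] at hx
    exact hA x hx
  obtain ⟨k, hk⟩ : fpoly (m+3) ∣ pull B (fpoly (m+3)) := by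
    apply dvd_of_vanish hs h0
    intro x hx
    rw [eval_pull, eval_fpoly]
    rw [eval_fpoly] at hx
    exact hB x hx
  have h1 : pull A (pull B (fpoly (m+3))) = fpoly (m+3) := by
    apply MvPolynomial.funext
    intro x
    rw [eval_pull, eval_pull, Matrix.mulVec_mulVec, hBA, Matrix.one_mulVec]
  rw [hk, map_mul, hh, mul_assoc] at h1
  have h2 : h * pull A k = 1 := by
    apply mul_left_cancel₀ h0
    rw [h1, mul_one]
  have h3 : IsUnit h := IsUnit.of_mul_eq_one _ h2
  obtain ⟨r, -, hr⟩ := MvPolynomial.isUnit_iff_eq_C_of_isReduced.1 h3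
  refine ⟨r, fun x => ?_⟩
  have := congrArg (MvPolynomial.eval x) hh
  rw [eval_pull, eval_fpoly, map_mul, eval_fpoly, hr, MvPolynomial.eval_C] at this
  rw [this, mul_comm]

open Polynomial in
theorem Dg_transfer {n k : ℕ} (A B : Matrix (Edge n) (Edge n) ℂ) (hAB : A * B = 1) (c : ℂ)
    (hA : ∀ x, FF (ext0 (A.mulVec x)) = c * FF (ext0 x)) (v : Edge n → ℂ) (hv : Dg k (ext0 v)) :
    Dg k (ext0 (A.mulVec v)) := by
  intro x
  let x' : Edge n → ℂ := fun e => x e.1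
  let y := B.mulVec x'
  have hy : A.mulVec y = x' := by simp only [y]; rw [Matrix.mulVec_mulVec, hAB, Matrix.one_mulVec]
  have hev : ∀ (z w : Edge n → ℂ) (a : Sym2 (Fin n) → ℂ) (_ : ∀ e : Edge n, a e.1 = z e) (t : ℂ), 
      Polynomial.eval t (FF (fun e => C (a e) + X * C (ext0 w e))) = FF (ext0 (z + t • w)) := by
    intro z w a ha t
    rw [← Polynomial.coe_evalRingHom, ← FF_map]
    apply FF_congr
    intro e he
    have h1 := ext0_edge w ⟨e, he⟩
    have h2 := ext0_edge (z + t • w) ⟨e, he⟩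
    have h3 := ha ⟨e, he⟩
    dsimp only at h1 h2 h3
    simp [h1, h2, h3]
    ring
  have : FF (fun e => C (x e) + X * C (ext0 (A.mulVec v) e)) = 
    C c * FF (fun e => C (ext0 y e) + X * C (ext0 v e)) := by
    apply Polynomial.funext
    intro t
    rw [Polynomial.eval_mul, Polynomial.eval_C, hev x' _ _ (fun e => rfl), hev y v _ (ext0_edge y),
      ← hA, Matrix.mulVec_add, Matrix.mulVec_smul, hy]
  rw [this]
  exact (natDegree_C_mul_le _ _).trans (hv _)


theorem ext0_sub_smul {n : ℕ} (u w : Edge n → ℂ) (t : ℂ) (e : Sym2 (Fin n)) :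
    ext0 (u - t • w) e = ext0 u e - t * ext0 w e := by
  unfold ext0
  split_ifs <;> simp

/-- star vectors with prescribed entries -/
def sv {n : ℕ} (i : Fin n) (s : Fin n → ℂ) : Sym2 (Fin n) → ℂ :=
  Sym2.lift ⟨fun a b => if a = i then s b else if b = i then s a else 0, fun a b => by
    by_cases ha : a = i <;> by_cases hb : b = i <;> simp [ha, hb]⟩

/-- star vectors on edges -/
def svE {n : ℕ} (i : Fin n) (s : Fin n → ℂ) : Edge n → ℂ := fun e => sv i s e.1

theorem ext0_svE {n : ℕ} (i : Fin n) (s : Fin n → ℂ) (a b : Fin n) (h : a ≠ b) :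
    ext0 (svE i s) s(a,b) = if a = i then s b else if b = i then s a else 0 := by
  have := ext0_edge (svE i s) ⟨s(a,b), by simpa using h⟩
  rw [this]; rfl

theorem svE_star {n : ℕ} (i : Fin n) (s : Fin n → ℂ) (hs : ∀ j, s j ^ 2 = 1) :
    StarAt i (ext0 (svE i s)) := by
  refine ⟨1, one_ne_zero, fun j hj => ?_, fun j k hj hk hjk => ?_⟩
  · rw [ext0_svE _ _ _ _ hj.symm]; simp [hs]
  · rw [ext0_svE _ _ _ _ hjk]; simp [hj, hk]

theorem svE_flip {n : ℕ} (i k : Fin n) (hik : ¬ s(i,k).IsDiag) (s : Fin n → ℂ) :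
    svE i (Function.update s k (- s k)) = svE i s - (2 * s k) • Pi.single (⟨s(i,k), hik⟩ : Edge n) 1 := by
  ext e
  obtain ⟨e, he⟩ := e
  have hik' : i ≠ k := by simpa using hik
  induction e with | h a b =>
  have hab : a ≠ b := by simpa using he
  simp only [svE, sv, Sym2.lift_mk, Pi.sub_apply, Pi.smul_apply, Pi.single_apply, Subtype.mk.injEq,
    Sym2.eq_iff, smul_eq_mul, Function.update_apply]
  by_cases ha : a = i
  · subst ha
    by_cases hb : b = k
    · subst hb; simp; ring
    · simp [hb, hik']
  · by_cases hb : b = i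
    · subst hb
      by_cases hak : a = k
      · subst hak; simp [ha]; ring
      · simp [ha, hak]
    · simp [ha, hb]

theorem exists_not_mem {n : ℕ} (S : Finset (Fin n)) (h : S.card < n) : ∃ p, p ∉ S := by
  by_contra hcon
  push Not at hcon
  have h1 : S = Finset.univ := Finset.eq_univ_iff_forall.2 hcon
  rw [h1, Finset.card_univ, Fintype.card_fin] at h
  omega

theorem refl_lemma {n : ℕ} (hn : 5 ≤ n) (v : Edge n → ℂ) (φ : (Edge n → ℂ) →ₗ[ℂ] ℂ) (i k : Fin n)
    (hik : ¬ s(i,k).IsDiag) (hφ : φ (Pi.single ⟨s(i,k), hik⟩ 1) ≠ 0)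
    (H : ∀ j u, StarAt j (ext0 u) → ∃ j', StarAt j' (ext0 (u - φ u • v))) :
    ∀ a b, a ≠ b → a ≠ i → b ≠ i → ext0 v s(a,b) = 0 := by
  have hflip : ∀ s : Fin n → ℂ, (∀ j, s j ^ 2 = 1) → ∃ s' : Fin n → ℂ, (∀ j, s' j ^ 2 = 1) ∧
      (∀ j, j ≠ k → s' j = s j) ∧ φ (svE i s') ≠ 0 := by
    intro s hs
    by_cases h : φ (svE i s) = 0
    · refine ⟨Function.update s k (- s k), fun j => ?_, fun j hj => ?_, ?_⟩
      · by_cases hj : j = k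
        · subst hj; simp [hs]
        · simp [hj, hs]
      · simp [hj]
      · rw [svE_flip i k hik, map_sub, h, map_smul, zero_sub, smul_eq_mul]
        have : s k ≠ 0 := by
          intro h0
          have := hs k
          simp [h0] at this
        simp [this, hφ]
    · exact ⟨s, hs, fun _ _ => rfl, h⟩
  intro a b hab hai hbi
  by_contra hv
  obtain ⟨s1, q1, t1, f1⟩ := hflip (fun _ => 1) (by simp)
  obtain ⟨k1, hk1⟩ := H i _ (svE_star i s1 q1)
  have off : ∀ s x y, x ≠ y → x ≠ i → y ≠ i →
      ext0 (svE i s - φ (svE i s) • v) s(x,y) = - φ (svE i s) * ext0 v s(x,y) := by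
    intro s x y hxy hx hy
    rw [ext0_sub_smul, ext0_svE _ _ _ _ hxy]
    simp [hx, hy]
  have hk1i : k1 ≠ i := by
    rintro rfl
    obtain ⟨β, h0, h1, h2⟩ := hk1
    have := h2 a b hai hbi hab
    rw [off _ _ _ hab hai hbi] at this
    simp [f1, hv] at this
  have hvne : ∀ c, c ≠ i → c ≠ k1 → ext0 v s(k1,c) ≠ 0 := by
    intro c hc hc1 h
    obtain ⟨β, h0, h1, h2⟩ := hk1
    have := h1 c hc1
    rw [off _ _ _ hc1.symm hk1i hc, h] at this
    simp at this
    exact h0 this.symm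
  -- two further vertices
  obtain ⟨p, q, hpq, hp, hq⟩ := exists_two ({i, k, k1} : Finset (Fin n))
      (by have := Finset.card_le_three (a := i) (b := k) (c := k1); omega)
  simp at hp hq
  obtain ⟨s2, q2, t2, f2⟩ := hflip (Function.update (fun _ => 1) p (-1)) (by
    intro j
    by_cases hj : j = p
    · subst hj; simp
    · simp [hj])
  obtain ⟨k2, hk2⟩ := H i _ (svE_star i s2 q2)
  have hk12 : k2 = k1 := by
    by_contra hne
    obtain ⟨c, hc⟩ := exists_not_mem ({i, k1, k2} : Finset (Fin n))
      (by have := Finset.card_le_three (a := i) (b := k1) (c := k2); omega)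
    simp at hc
    obtain ⟨β, h0, h1, h2⟩ := hk2
    have := h2 k1 c (Ne.symm hne) hc.2.2 (Ne.symm hc.2.1)
    rw [off _ _ _ (Ne.symm hc.2.1) hk1i hc.1] at this
    simp [f2] at this
    exact hvne c hc.1 hc.2.1 this
  subst hk12
  have val : ∀ s, StarAt k2 (ext0 (svE i s - φ (svE i s) • v)) → ∀ j, j ≠ i → j ≠ k2 →
      s j = φ (svE i s) * ext0 v s(i,j) := by
    rintro s ⟨β, h0, h1, h2⟩ j hj hj2
    have := h2 i j hk1i.symm hj2 hj.symm
    rw [ext0_sub_smul, ext0_svE _ _ _ _ hj.symm] at this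
    simp at this
    linear_combination this
  have a1 := val s1 hk1 p hp.1 hp.2.2
  have a2 := val s1 hk1 q hq.1 hq.2.2
  have a3 := val s2 hk2 p hp.1 hp.2.2
  have a4 := val s2 hk2 q hq.1 hq.2.2
  rw [t1 _ hp.2.1] at a1
  rw [t1 _ hq.2.1] at a2
  rw [t2 _ hp.2.1] at a3
  rw [t2 _ hq.2.1] at a4
  simp at a3
  rw [Function.update_of_ne hpq.symm] at a4
  have e1 : ext0 v s(i,p) = ext0 v s(i,q) := mul_left_cancel₀ f1 (by rw [← a1, ← a2])
  rw [e1, ← a4] at a3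
  norm_num at a3


theorem starAt_ne_zero {n : ℕ} (hn : 2 ≤ n) {i : Fin n} {u : Edge n → ℂ} (h : StarAt i (ext0 u)) : u ≠ 0 := by
  rintro rfl
  obtain ⟨β, h0, h1, -⟩ := h
  obtain ⟨j, hj⟩ := exists_not_mem ({i} : Finset (Fin n)) (by simp; omega)
  have := h1 j (by simpa using hj)
  simp [ext0] at this
  exact h0 this.symm

theorem star_map {n : ℕ} (hn : 3 ≤ n) (A B : Matrix (Edge n) (Edge n) ℂ) (hAB : A * B = 1) (hBA : B * A = 1)
    (c : ℂ) (hA : ∀ x, FF (ext0 (A.mulVec x)) = c * FF (ext0 x)) {i : Fin n} {u : Edge n → ℂ}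
    (h : StarAt i (ext0 u)) : ∃ j, StarAt j (ext0 (A.mulVec u)) := by
  have h1 := Dg_transfer A B hAB c hA u (star_Dg h)
  have hne : A.mulVec u ≠ 0 := by
    intro h0
    apply starAt_ne_zero (by omega) h
    have := congrArg B.mulVec h0
    rwa [Matrix.mulVec_mulVec, hBA, Matrix.one_mulVec, Matrix.mulVec_zero] at this
  obtain ⟨⟨e, he⟩, hx⟩ := Function.ne_iff.1 hne
  induction e with | h a b =>
  refine Dg2_star hn h1 (a := a) (b := b) (by simpa using he) ?_
  have := ext0_edge (A.mulVec u) ⟨s(a,b), he⟩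
  dsimp only at this
  rw [this]
  exact hx

theorem star_flip {n : ℕ} {i : Fin n} {u : Edge n → ℂ} (h : StarAt i (ext0 u)) (e : Edge n) :
    StarAt i (ext0 (u - (2 * u e) • Pi.single e 1)) := by
  have key : ∀ e', ext0 (u - (2 * u e) • Pi.single e 1) e' = ext0 u e' ∨
      ext0 (u - (2 * u e) • Pi.single e 1) e' = - ext0 u e' := by
    intro e'
    unfold ext0
    split_ifs with hd
    · simp
    · by_cases he : (⟨e', hd⟩ : Edge n) = e
      · right; subst he; simp; ring
      · left; simp [he]
  obtain ⟨β, h0, h1, h2⟩ := h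
  refine ⟨β, h0, fun j hj => ?_, fun j k hj hk hjk => ?_⟩
  · rw [← h1 j hj]
    rcases key s(i,j) with h | h <;> rw [h]
    ring
  · have := h2 j k hj hk hjk
    rcases key s(j,k) with h | h <;> rw [h, this]
    simp

theorem star_mem {n : ℕ} {i : Fin n} {u : Edge n → ℂ} (h : StarAt i (ext0 u)) :
    ∃ β : ℂ, β ≠ 0 ∧ ∀ e : Edge n, (i ∈ e.1 → u e ^ 2 = β) ∧ (i ∉ e.1 → u e = 0) := by
  obtain ⟨β, h0, h1, h2⟩ := h
  refine ⟨β, h0, ?_⟩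
  rintro ⟨e, he⟩
  rw [← ext0_edge u]
  induction e with | h a b =>
  have hab : a ≠ b := by simpa using he
  constructor
  · intro hi
    rcases Sym2.mem_iff.1 hi with rfl | rfl
    · exact h1 b hab.symm
    · dsimp only; rw [Sym2.eq_swap]; exact h1 a hab
  · intro hi
    rw [Sym2.mem_iff] at hi
    push Not at hi
    exact h2 a b (Ne.symm hi.1) (Ne.symm hi.2) hab

theorem col_support {n : ℕ} (hn : 5 ≤ n) (A B : Matrix (Edge n) (Edge n) ℂ) (hAB : A * B = 1) (hBA : B * A = 1)
    (c c' : ℂ) (hA : ∀ x, FF (ext0 (A.mulVec x)) = c * FF (ext0 x))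
    (hB : ∀ x, FF (ext0 (B.mulVec x)) = c' * FF (ext0 x)) (e : Edge n) :
    ∃ e', ∀ f, f ≠ e' → A f e = 0 := by
  have hrow : ∃ e', B e e' ≠ 0 := by
    by_contra hcon
    push Not at hcon
    have : (B * A) e e = 0 := by simp [Matrix.mul_apply, hcon]
    rw [hBA] at this
    simp at this
  obtain ⟨e', he'⟩ := hrow
  refine ⟨e', ?_⟩
  let φ : (Edge n → ℂ) →ₗ[ℂ] ℂ := (2 : ℂ) • (LinearMap.proj e ∘ₗ B.mulVecLin)
  have hφ : ∀ u, φ u = 2 * B.mulVec u e := fun u => by simp [φ]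
  have H : ∀ j u, StarAt j (ext0 u) → ∃ j', StarAt j' (ext0 (u - φ u • A.mulVec (Pi.single e 1))) := by
    intro j u hu
    obtain ⟨j1, h1⟩ := star_map (by omega) B A hBA hAB c' hB hu
    obtain ⟨j2, h2⟩ := star_map (by omega) A B hAB hBA c hA (star_flip h1 e)
    refine ⟨j2, ?_⟩
    rw [Matrix.mulVec_sub, Matrix.mulVec_smul, Matrix.mulVec_mulVec, hAB, Matrix.one_mulVec, ← hφ] at h2
    exact h2
  obtain ⟨⟨e', hd⟩, rfl⟩ : ∃ x, x = e' := ⟨e', rfl⟩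
  induction e' with | h i k =>
  have hd' : ¬ s(k,i).IsDiag := by rwa [Sym2.eq_swap]
  have hp : φ (Pi.single ⟨s(i,k), hd⟩ 1) ≠ 0 := by
    rw [hφ]; simpa using he'
  have K1 := refl_lemma hn (A.mulVec (Pi.single e 1)) φ i k hd hp H
  have K2 := refl_lemma hn (A.mulVec (Pi.single e 1)) φ k i hd' (by
    convert hp using 4
    exact Sym2.eq_swap) H
  rintro ⟨f, hf⟩ hne
  have e1 : A ⟨f, hf⟩ e = ext0 (A.mulVec (Pi.single e 1)) f := by
    have := ext0_edge (A.mulVec (Pi.single e 1)) ⟨f, hf⟩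
    dsimp only at this
    rw [this]; simp
  rw [e1]
  have hne' : f ≠ s(i,k) := by
    intro h; apply hne; exact Subtype.ext h
  induction f with | h a b =>
  have hab : a ≠ b := by simpa using hf
  by_cases h1 : a ≠ i ∧ b ≠ i
  · exact K1 a b hab h1.1 h1.2
  by_cases h2 : a ≠ k ∧ b ≠ k
  · exact K2 a b hab h2.1 h2.2
  exfalso
  have hik : i ≠ k := by simpa using hd
  apply hne'
  rw [Sym2.eq_iff]
  clear * - h1 h2 hab hik
  grind

theorem final {n : ℕ} (hn : 5 ≤ n) (A B : Matrix (Edge n) (Edge n) ℂ) (hAB : A * B = 1) (hBA : B * A = 1)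
    (c c' : ℂ) (hA : ∀ x, FF (ext0 (A.mulVec x)) = c * FF (ext0 x))
    (hB : ∀ x, FF (ext0 (B.mulVec x)) = c' * FF (ext0 x)) :
    ∃ (c : ℂ) (sgn : Edge n → ℂ) (σ : Equiv.Perm (Fin n)), c ≠ 0 ∧
      (∀ e, sgn e = 1 ∨ sgn e = -1) ∧
      ∀ e f : Edge n, A e f =
        if (e : Sym2 (Fin n)) = Sym2.map σ (f : Sym2 (Fin n))
          then c * sgn e else 0 := by
  choose π hπ using col_support hn A B hAB hBA c c' hA hB
  have hBAe : ∀ f e, B f (π e) * A (π e) e = if f = e then 1 else 0 := by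
    intro f e
    have : (B * A) f e = B f (π e) * A (π e) e := by
      rw [Matrix.mul_apply, Finset.sum_eq_single (π e)]
      · intro g _ hg; rw [hπ e g hg, mul_zero]
      · simp
    rw [← this, hBA, Matrix.one_apply]
  have hinj : Function.Injective π := by
    intro e f hef
    by_contra hne
    have h1 := hBAe f e
    have h2 := hBAe f f
    have h3 := hBAe e e
    simp only [Ne.symm hne, if_false, if_true, mul_eq_zero] at h1 h2 h3
    rcases h1 with h1 | h1
    · rw [← hef, h1] at h2; simp at h2
    · rw [h1] at h3; simp at h3
  have hcne : ∀ e, A (π e) e ≠ 0 := by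
    intro e h
    have := hBAe e e
    simp [h] at this
  have hAu : ∀ u f, A.mulVec u (π f) = A (π f) f * u f := by
    intro u f
    rw [Matrix.mulVec, dotProduct, Finset.sum_eq_single f]
    · intro g _ hg
      rw [hπ g (π f) (fun h => hg (hinj h.symm)), zero_mul]
    · simp
  have hst : ∀ i, ∃ j, ∃ β : ℂ, β ≠ 0 ∧ ∀ f : Edge n, (i ∈ f.1 ↔ j ∈ (π f).1) ∧
      (i ∈ f.1 → A (π f) f ^ 2 = β) := by
    intro i
    have hs := svE_star i (fun _ => 1) (by simp)
    obtain ⟨j, hj⟩ := star_map (by omega) A B hAB hBA c hA hs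
    obtain ⟨β, h0, h1⟩ := star_mem hj
    have hu : ∀ f : Edge n, svE i (fun _ => 1) f = if i ∈ f.1 then 1 else 0 := by
      rintro ⟨f, hf⟩
      induction f with | h a b =>
      simp only [svE, sv, Sym2.lift_mk, Sym2.mem_iff]
      by_cases ha : a = i
      · simp [ha]
      · by_cases hb : b = i
        · simp [hb]
        · simp [ha, hb, Ne.symm ha, Ne.symm hb]
    refine ⟨j, β, h0, fun f => ?_⟩
    obtain ⟨h2, h3⟩ := h1 (π f)
    rw [hAu, hu] at h2 h3
    have hc := hcne f
    by_cases hi : i ∈ f.1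
    · simp only [hi, if_true, mul_one] at h2 h3
      by_cases hj : j ∈ (π f).1
      · exact ⟨by simp [hi, hj], fun _ => h2 hj⟩
      · exact absurd (h3 hj) hc
    · simp only [hi, if_false, mul_zero] at h2 h3
      refine ⟨?_, fun h => absurd h hi⟩
      simp only [hi, false_iff]
      intro hj
      have := h2 hj
      simp at this
      exact h0 this.symm
  choose σ0 β hβ0 hβ using hst
  have hσinj : Function.Injective σ0 := by
    intro i j hij
    by_contra hne
    obtain ⟨k, hk⟩ := exists_not_mem ({i, j} : Finset (Fin n))
      (by have := Finset.card_le_two (a := i) (b := j); omega)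
    simp at hk
    have h1 := (hβ i ⟨s(i,k), by simpa using Ne.symm hk.1⟩).1.1 (by simp)
    rw [hij] at h1
    have h2 := (hβ j ⟨s(i,k), by simpa using Ne.symm hk.1⟩).1.2 h1
    rw [Sym2.mem_iff] at h2
    rcases h2 with h2 | h2
    · exact hne h2.symm
    · exact hk.2 h2.symm
  let σ : Equiv.Perm (Fin n) := Equiv.ofBijective σ0 (Finite.injective_iff_bijective.1 hσinj)
  have hπσ : ∀ f : Edge n, (π f).1 = Sym2.map σ f.1 := by
    rintro ⟨f, hf⟩
    induction f with | h i j =>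
    have hij : i ≠ j := by simpa using hf
    have h1 := (hβ i ⟨s(i,j), hf⟩).1.1 (by simp)
    have h2 := (hβ j ⟨s(i,j), hf⟩).1.1 (by simp)
    rw [Sym2.map_mk]
    exact (Sym2.mem_and_mem_iff (hσinj.ne hij)).1 ⟨h1, h2⟩
  have hββ : ∀ i j, β i = β j := by
    intro i j
    by_cases hij : i = j
    · rw [hij]
    · rw [← (hβ i ⟨s(i,j), by simpa using hij⟩).2 (by simp), ← (hβ j ⟨s(i,j), by simpa using hij⟩).2 (by simp)]
  let i0 : Fin n := ⟨0, by omega⟩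
  have hall : ∀ f, A (π f) f ^ 2 = β i0 := by
    rintro ⟨f, hf⟩
    induction f with | h i j =>
    rw [(hβ i ⟨s(i,j), hf⟩).2 (by simp), hββ i i0]
  obtain ⟨γ, hγ⟩ := IsAlgClosed.exists_pow_nat_eq (β i0) two_pos
  have hγ0 : γ ≠ 0 := by
    rintro rfl
    apply hβ0 i0
    rw [← hγ]; simp
  have hπsurj := Finite.injective_iff_surjective.1 hinj
  choose ρ hρ using hπsurj
  refine ⟨γ, fun e => A e (ρ e) / γ, σ, hγ0, ?_, ?_⟩
  · intro e
    have h := hall (ρ e)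
    rw [hρ, ← hγ] at h
    rw [← sq_eq_one_iff, div_pow, h, div_self (pow_ne_zero 2 hγ0)]
  · intro e f
    rw [← hπσ f]
    by_cases he : e = π f
    · subst he
      have : ρ (π f) = f := hinj (hρ _)
      simp only [if_true, this]
      field_simp
    · rw [if_neg (fun h => he (Subtype.ext h)), hπ f e he]


theorem automorphisms_of_L_minimal_are_signed_vertex_relabelings
    {d : ℕ} (hd : 3 ≤ d)
    (A : Matrix (Edge (d + 2)) (Edge (d + 2)) ℂ)
    (hunit : IsUnit A.det)
    (haut : (fun x => A.mulVec x) '' Lvar d (d + 2) = Lvar d (d + 2)) :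
    ∃ (c : ℂ) (sgn : Edge (d + 2) → ℂ) (σ : Equiv.Perm (Fin (d + 2))), c ≠ 0 ∧
      (∀ e, sgn e = 1 ∨ sgn e = -1) ∧
      ∀ e f : Edge (d + 2), A e f =
        if (e : Sym2 (Fin (d + 2))) = Sym2.map σ (f : Sym2 (Fin (d + 2)))
          then c * sgn e else 0 := by
  have hAB : A * A⁻¹ = 1 := Matrix.mul_nonsing_inv A hunit
  have hBA : A⁻¹ * A = 1 := Matrix.nonsing_inv_mul A hunit
  have h1 : ∀ x, FF (ext0 x) = 0 → FF (ext0 (A.mulVec x)) = 0 := by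
    intro x hx
    rw [← L_iff] at hx ⊢
    rw [← haut]
    exact ⟨x, hx, rfl⟩
  have h2 : ∀ x, FF (ext0 x) = 0 → FF (ext0 (A⁻¹.mulVec x)) = 0 := by
    intro x hx
    rw [← L_iff] at hx ⊢
    rw [← haut] at hx
    obtain ⟨y, hy, rfl⟩ := hx
    simp only [Matrix.mulVec_mulVec, hBA, Matrix.one_mulVec]
    exact hy
  obtain ⟨m, rfl⟩ : ∃ m, d = m + 1 := ⟨d - 1, by omega⟩
  obtain ⟨c, hc⟩ := FF_scale (m := m) A A⁻¹ hBA h1 h2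
  obtain ⟨c', hc'⟩ := FF_scale (m := m) A⁻¹ A hAB h2 h1
  exact final (by omega) A A⁻¹ hAB hBA c c' hc hc'
end
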